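/- For every nonzero primitive element x ∈ P(Ū), the functional ⟨·, x⟩ : B → ℂ on the quantum Grassmannian B = O_q(Gr(r,N)) is nonzero. -/

import Mathlib

noncomputable section

open scoped TensorProduct

/-- Cartan integers of `sl_N`. -/
def cartanSL (i j : ℕ) : ℤ :=
  if i = j then 2 else if ((i : ℤ) - j).natAbs = 1 then -1 else 0

/-- The defining relations of `U_q(sl_N)` for a candidate family of generators. -/
def UqslRels (q : ℝ) (N : ℕ) {V : Type} [Ring V] [Algebra ℂ V]
    (e f kg ki : ℕ → V) : Prop :=
  (∀ i ∈ Finset.Icc 1 (N - 1), kg i * ki i = 1 ∧ ki i * kg i = 1) ∧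
  (∀ i ∈ Finset.Icc 1 (N - 1), ∀ j ∈ Finset.Icc 1 (N - 1),
      kg i * kg j = kg j * kg i) ∧
  (∀ i ∈ Finset.Icc 1 (N - 1), ∀ j ∈ Finset.Icc 1 (N - 1),
      kg i * e j = ((q : ℂ) ^ (cartanSL i j)) • (e j * kg i)) ∧
  (∀ i ∈ Finset.Icc 1 (N - 1), ∀ j ∈ Finset.Icc 1 (N - 1),
      kg i * f j = ((q : ℂ) ^ (-cartanSL i j)) • (f j * kg i)) ∧
  (∀ i ∈ Finset.Icc 1 (N - 1), ∀ j ∈ Finset.Icc 1 (N - 1),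
      e i * f j - f j * e i =
        if i = j then (((q : ℂ) - (q : ℂ)⁻¹)⁻¹) • (kg i - ki i) else 0) ∧
  (∀ i ∈ Finset.Icc 1 (N - 1), ∀ j ∈ Finset.Icc 1 (N - 1), ((i : ℤ) - j).natAbs = 1 →
      e i * e i * e j - ((q : ℂ) + (q : ℂ)⁻¹) • (e i * e j * e i) + e j * e i * e i = 0) ∧
  (∀ i ∈ Finset.Icc 1 (N - 1), ∀ j ∈ Finset.Icc 1 (N - 1), 2 ≤ ((i : ℤ) - j).natAbs →
      e i * e j = e j * e i) ∧
  (∀ i ∈ Finset.Icc 1 (N - 1), ∀ j ∈ Finset.Icc 1 (N - 1), ((i : ℤ) - j).natAbs = 1 →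
      f i * f i * f j - ((q : ℂ) + (q : ℂ)⁻¹) • (f i * f j * f i) + f j * f i * f i = 0) ∧
  (∀ i ∈ Finset.Icc 1 (N - 1), ∀ j ∈ Finset.Icc 1 (N - 1), 2 ≤ ((i : ℤ) - j).natAbs →
      f i * f j = f j * f i)

/-- The quantized enveloping algebra `U_q(sl_N)` together with its Hopf algebra
structure, generators, defining relations and universal property. -/
structure UqslData (q : ℝ) (N : ℕ) where
  U : Type
  [instRing : Ring U]
  [instHopf : HopfAlgebra ℂ U]
  E : ℕ → U
  F : ℕ → U
  Kg : ℕ → U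
  Ki : ℕ → U
  rels : UqslRels q N E F Kg Ki
  comul_E : ∀ i ∈ Finset.Icc 1 (N - 1),
    Coalgebra.comul (R := ℂ) (E i) = E i ⊗ₜ[ℂ] 1 + Kg i ⊗ₜ[ℂ] E i
  comul_F : ∀ i ∈ Finset.Icc 1 (N - 1),
    Coalgebra.comul (R := ℂ) (F i) = F i ⊗ₜ[ℂ] Ki i + 1 ⊗ₜ[ℂ] F i
  comul_Kg : ∀ i ∈ Finset.Icc 1 (N - 1),
    Coalgebra.comul (R := ℂ) (Kg i) = Kg i ⊗ₜ[ℂ] Kg i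
  comul_Ki : ∀ i ∈ Finset.Icc 1 (N - 1),
    Coalgebra.comul (R := ℂ) (Ki i) = Ki i ⊗ₜ[ℂ] Ki i
  counit_E : ∀ i ∈ Finset.Icc 1 (N - 1), Coalgebra.counit (R := ℂ) (E i) = 0
  counit_F : ∀ i ∈ Finset.Icc 1 (N - 1), Coalgebra.counit (R := ℂ) (F i) = 0
  counit_Kg : ∀ i ∈ Finset.Icc 1 (N - 1), Coalgebra.counit (R := ℂ) (Kg i) = 1
  counit_Ki : ∀ i ∈ Finset.Icc 1 (N - 1), Coalgebra.counit (R := ℂ) (Ki i) = 1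
  gen : Algebra.adjoin ℂ
      {x : U | ∃ i ∈ Finset.Icc 1 (N - 1), x = E i ∨ x = F i ∨ x = Kg i ∨ x = Ki i} = ⊤
  univ : ∀ (V : Type) [Ring V] [Algebra ℂ V] (e f kg ki : ℕ → V),
      UqslRels q N e f kg ki → ∃ φ : U →ₐ[ℂ] V,
        ∀ i ∈ Finset.Icc 1 (N - 1),
          φ (E i) = e i ∧ φ (F i) = f i ∧ φ (Kg i) = kg i ∧ φ (Ki i) = ki i

attribute [instance] UqslData.instRing UqslData.instHopf

namespace UqslData

variable {q : ℝ} {N : ℕ} (D : UqslData q N)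

/-- Root vectors `E_{α_{i,i+d}}` (iterated `q`-commutators with respect to the
standard reduced decomposition of the longest Weyl group element). -/
def Ev : ℕ → ℕ → D.U
  | 0, i => D.E i
  | d + 1, i => D.E i * Ev d (i + 1) - (q : ℂ)⁻¹ • (Ev d (i + 1) * D.E i)

/-- Root vectors `F_{α_{i,i+d}}`. -/
def Fv : ℕ → ℕ → D.U
  | 0, i => D.F i
  | d + 1, i => Fv d (i + 1) * D.F i - (q : ℂ)⁻¹ • (D.F i * Fv d (i + 1))

/-- The Hopf subalgebra `K` generated by `E_i, F_i (i ≠ r)` and all `K_j^{±1}`. -/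
def Ksub (r : ℕ) : Subalgebra ℂ D.U :=
  Algebra.adjoin ℂ
    ({x : D.U | ∃ i ∈ Finset.Icc 1 (N - 1), i ≠ r ∧ (x = D.E i ∨ x = D.F i)} ∪
     {x : D.U | ∃ j ∈ Finset.Icc 1 (N - 1), x = D.Kg j ∨ x = D.Ki j})

/-- The subspace `K⁺U ⊆ U`. -/
def Jsub (r : ℕ) : Submodule ℂ D.U :=
  Submodule.span ℂ
    {x : D.U | ∃ k ∈ D.Ksub r, Coalgebra.counit (R := ℂ) k = 0 ∧ ∃ u : D.U, x = k * u}

/-- The subspace `K⁺U ⊗ U + U ⊗ K⁺U` of `U ⊗ U`, i.e. the kernel of `π ⊗ π` where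
`π : U → U/K⁺U` is the canonical projection. -/
def JUU (r : ℕ) : Submodule ℂ (D.U ⊗[ℂ] D.U) :=
  LinearMap.range (TensorProduct.map (D.Jsub r).subtype LinearMap.id) ⊔
  LinearMap.range (TensorProduct.map LinearMap.id (D.Jsub r).subtype)

/-- `x ∈ U` represents a primitive element of the quotient coalgebra `Ū = U/K⁺U`. -/
def IsPrimitiveMod (r : ℕ) (x : D.U) : Prop :=
  Coalgebra.comul (R := ℂ) x - x ⊗ₜ[ℂ] 1 - 1 ⊗ₜ[ℂ] x ∈ D.JUU r

end UqslData

/-- Membership of the pair `(i,j)` in (the index set of) `Φ⁺_r`, the set of positive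
roots `α_{ij} = α_i + ⋯ + α_j` of `sl_N` with `i ≤ r ≤ j`. -/
def inPhiR (N r : ℕ) (p : ℕ × ℕ) : Prop :=
  1 ≤ p.1 ∧ p.1 ≤ r ∧ r ≤ p.2 ∧ p.2 ≤ N - 1



/-- The quantized function algebra `A = O_q(SL_N)` together with the nondegenerate Hopf
pairing with `U = U_q(sl_N)`:  `A` is a Hopf algebra generated by the matrix coefficients
`u^i_j` of the fundamental corepresentation, and the pairing is fixed by its values on
the generators (the fundamental representation of `U_q(sl_N)`). -/
structure QslnFun (q : ℝ) (N : ℕ) (D : UqslData q N) where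
  A : Type
  [instRingA : Ring A]
  [instHopfA : HopfAlgebra ℂ A]
  u : ℕ → ℕ → A
  genA : Algebra.adjoin ℂ
      {x : A | ∃ i ∈ Finset.Icc 1 N, ∃ j ∈ Finset.Icc 1 N, x = u i j} = ⊤
  comul_u : ∀ i ∈ Finset.Icc 1 N, ∀ j ∈ Finset.Icc 1 N,
    Coalgebra.comul (R := ℂ) (u i j) = ∑ k ∈ Finset.Icc 1 N, u i k ⊗ₜ[ℂ] u k j
  counit_u : ∀ i ∈ Finset.Icc 1 N, ∀ j ∈ Finset.Icc 1 N,
    Coalgebra.counit (R := ℂ) (u i j) = if i = j then 1 else 0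
  pair : D.U →ₗ[ℂ] A →ₗ[ℂ] ℂ
  pair_mulU : ∀ (x y : D.U) (a : A), pair (x * y) a =
    LinearMap.mul' ℂ ℂ (TensorProduct.map (pair x) (pair y) (Coalgebra.comul (R := ℂ) a))
  pair_mulA : ∀ (x : D.U) (a b : A), pair x (a * b) =
    LinearMap.mul' ℂ ℂ (TensorProduct.map (pair.flip a) (pair.flip b)
      (Coalgebra.comul (R := ℂ) x))
  pair_oneU : ∀ a : A, pair 1 a = Coalgebra.counit (R := ℂ) a
  pair_oneA : ∀ x : D.U, pair x 1 = Coalgebra.counit (R := ℂ) x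
  pair_antipode : ∀ (x : D.U) (a : A),
    pair (HopfAlgebra.antipode (R := ℂ) x) a = pair x (HopfAlgebra.antipode (R := ℂ) a)
  pair_E : ∀ l ∈ Finset.Icc 1 (N - 1), ∀ i ∈ Finset.Icc 1 N, ∀ j ∈ Finset.Icc 1 N,
    pair (D.E l) (u i j) = if i = l ∧ j = l + 1 then 1 else 0
  pair_F : ∀ l ∈ Finset.Icc 1 (N - 1), ∀ i ∈ Finset.Icc 1 N, ∀ j ∈ Finset.Icc 1 N,
    pair (D.F l) (u i j) = if i = l + 1 ∧ j = l then 1 else 0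
  pair_Kg : ∀ l ∈ Finset.Icc 1 (N - 1), ∀ i ∈ Finset.Icc 1 N, ∀ j ∈ Finset.Icc 1 N,
    pair (D.Kg l) (u i j) =
      if i = j then (if i = l then (q : ℂ) else if i = l + 1 then (q : ℂ)⁻¹ else 1) else 0
  pair_Ki : ∀ l ∈ Finset.Icc 1 (N - 1), ∀ i ∈ Finset.Icc 1 N, ∀ j ∈ Finset.Icc 1 N,
    pair (D.Ki l) (u i j) =
      if i = j then (if i = l then (q : ℂ)⁻¹ else if i = l + 1 then (q : ℂ) else 1) else 0
  nondegU : ∀ x : D.U, (∀ a : A, pair x a = 0) → x = 0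
  nondegA : ∀ a : A, (∀ x : D.U, pair x a = 0) → a = 0

attribute [instance] QslnFun.instRingA QslnFun.instHopfA

namespace QslnFun

variable {q : ℝ} {N : ℕ} {D : UqslData q N} (P : QslnFun q N D)

/-- For `k : U`, the operator `a ↦ ⟨k, a₍₁₎⟩ a₍₂₎` on `A`. -/
def hitL (k : D.U) : P.A →ₗ[ℂ] P.A :=
  TensorProduct.lift ((LinearMap.lsmul ℂ P.A).comp (P.pair k)) ∘ₗ
    Coalgebra.comul (R := ℂ)

/-- The quantum Grassmannian `B = O_q(Gr(r,N))` inside `A`, as the subspace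
`{b ∈ A | ⟨k, b₍₁₎⟩ b₍₂₎ = 0 for all k ∈ K⁺}`. -/
def Bmod (r : ℕ) : Submodule ℂ P.A :=
  ⨅ k : ↥(D.Ksub r),
    LinearMap.ker (P.hitL ((k : D.U) - algebraMap ℂ D.U
      (Coalgebra.counit (R := ℂ) (k : D.U))))

end QslnFun



section

set_option linter.unusedSectionVars false
/-- One half (positive or negative) of a quantized enveloping algebra `U` paired with an
algebra `A`, together with the elements of `A` used to detect the nilradical. -/
structure QuantumHalf (ι U A : Type) [DecidableEq ι] [Ring U] [Algebra ℂ U] [Ring A]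
    [Algebra ℂ A] where
  q : ℂ
  κ : ℂ
  c : ι → ι → ℤ
  r : ι
  E : ι → U
  F : ι → U
  K : ι → U
  Ki : ι → U
  pair : U →ₗ[ℂ] A →ₗ[ℂ] ℂ
  hL : U → A → A
  hR : U → A → A
  g : ι → A
  m : A
  q_ne : q ≠ 0
  q_pow : ∀ k : ℤ, k ≠ 0 → q ^ k ≠ 1
  κ_ne : κ ≠ 0
  c_symm : ∀ i j, c i j = c j i
  c_pos : ∀ β : Multiset ι, β ≠ 0 → (β.map fun i => (β.map (c i)).sum).sum ≠ 0
  K_Ki : ∀ i, K i * Ki i = 1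
  Ki_K : ∀ i, Ki i * K i = 1
  K_K : ∀ i j, K i * K j = K j * K i
  K_E : ∀ i j, K i * E j = q ^ c i j • (E j * K i)
  E_F : ∀ i j, E i * F j - F j * E i = if i = j then κ • (K i - Ki i) else 0
  rep : ∀ x : U, (∀ (n : Type) [Fintype n] [DecidableEq n] (ρ : U →ₐ[ℂ] Matrix n n ℂ),
    (∀ i, (ρ (E i)).conjTranspose = q • (ρ (K i) * ρ (F i))) → ρ x = 0) → x = 0
  pair_hL : ∀ u v a, pair v (hL u a) = pair (u * v) a
  pair_hR : ∀ u v a, pair v (hR u a) = pair (v * u) a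
  nondegU : ∀ x, (∀ a, pair x a = 0) → x = 0
  nondegA : ∀ a, (∀ x, pair x a = 0) → a = 0
  hL_E_mul : ∀ i a b, hL (E i) (a * b) = hL (E i) a * b + hL (K i) a * hL (E i) b
  hL_F_mul : ∀ i a b, hL (F i) (a * b) = hL (F i) a * hL (Ki i) b + a * hL (F i) b
  hL_K_mul : ∀ i a b, hL (K i) (a * b) = hL (K i) a * hL (K i) b
  hL_Ki_mul : ∀ i a b, hL (Ki i) (a * b) = hL (Ki i) a * hL (Ki i) b
  pair_one : ∀ a b, pair 1 (a * b) = pair 1 a * pair 1 b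
  g_wt : ∀ i j, ∃ χ : ℂ, χ ≠ 0 ∧ (∀ v, pair (K j * v) (g i) = χ * pair v (g i)) ∧
    ∀ v, pair (v * K j) (g i) = χ * pair v (g i)
  g_ne : ∀ i, pair (K i) (g i) ≠ pair (Ki i) (g i)
  m_F : ∀ i, hL (F i) m = 0
  m_E : ∀ i, i ≠ r → hL (E i) m = 0
  m_KL : ∀ i v, pair (K i * v) m = (if i = r then q else 1) * pair v m
  m_KR : ∀ i v, pair (v * K i) m = (if i = r then q else 1) * pair v m
  m_one : pair 1 m = 1

namespace QuantumHalf

variable {ι U A : Type} [DecidableEq ι] [Ring U] [Algebra ℂ U] [Ring A] [Algebra ℂ A]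
  (H : QuantumHalf ι U A)

/-- The monomial in the `E i` attached to a word. -/
def word (w : List ι) : U := (w.map H.E).prod

/-- Evaluation of noncommutative polynomials at the `E i`. -/
def ev : (List ι →₀ ℂ) →ₗ[ℂ] U := Finsupp.linearCombination ℂ H.word

/-- The pairing of `α_i` with a weight. -/
def wt (i : ι) (β : Multiset ι) : ℤ := (β.map (H.c i)).sum

/-- Left multiplication by a letter. -/
def consL (j : ι) : (List ι →₀ ℂ) →ₗ[ℂ] (List ι →₀ ℂ) := Finsupp.lmapDomain ℂ ℂ (List.cons j)

/-- Right multiplication by a letter. -/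
def snocL (j : ι) : (List ι →₀ ℂ) →ₗ[ℂ] (List ι →₀ ℂ) :=
  Finsupp.lmapDomain ℂ ℂ (fun w => w ++ [j])

/-- The right skew derivation on words. -/
def dW (i : ι) : List ι → (List ι →₀ ℂ)
  | [] => 0
  | j :: w => (if i = j then Finsupp.single w (H.q ^ H.wt i w) else 0) + consL j (dW i w)

/-- The left skew derivation on words. -/
def dW' (i : ι) : List ι → (List ι →₀ ℂ)
  | [] => 0
  | j :: w => (if i = j then Finsupp.single w 1 else 0) + H.q ^ H.c i j • consL j (dW' i w)

/-- The right skew derivation. -/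
def d (i : ι) : (List ι →₀ ℂ) →ₗ[ℂ] (List ι →₀ ℂ) := Finsupp.linearCombination ℂ (H.dW i)

/-- The left skew derivation. -/
def d' (i : ι) : (List ι →₀ ℂ) →ₗ[ℂ] (List ι →₀ ℂ) := Finsupp.linearCombination ℂ (H.dW' i)

/-- Noncommutative polynomials of a given weight. -/
def homog (β : Multiset ι) : Submodule ℂ (List ι →₀ ℂ) :=
  Finsupp.supported ℂ ℂ {w | (w : Multiset ι) = β}

@[simp] lemma word_nil : H.word [] = 1 := rfl

@[simp] lemma word_cons (j : ι) (w : List ι) : H.word (j :: w) = H.E j * H.word w := by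
  simp [word]

@[simp] lemma ev_single (w : List ι) (z : ℂ) : H.ev (Finsupp.single w z) = z • H.word w := by
  simp [ev]

@[simp] lemma d_single (i : ι) (w : List ι) (z : ℂ) :
    H.d i (Finsupp.single w z) = z • H.dW i w := by simp [d]

@[simp] lemma d'_single (i : ι) (w : List ι) (z : ℂ) :
    H.d' i (Finsupp.single w z) = z • H.dW' i w := by simp [d']

@[simp] lemma consL_single (j : ι) (w : List ι) (z : ℂ) :
    consL j (Finsupp.single w z) = Finsupp.single (j :: w) z := by simp [consL]

@[simp] lemma snocL_single (j : ι) (w : List ι) (z : ℂ) :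
    snocL j (Finsupp.single w z) = Finsupp.single (w ++ [j]) z := by simp [snocL]

@[simp] lemma wt_zero (i : ι) : H.wt i 0 = 0 := by simp [wt]

@[simp] lemma wt_cons (i j : ι) (w : List ι) :
    H.wt i ((j :: w : List ι) : Multiset ι) = H.c i j + H.wt i (w : Multiset ι) := by
  simp [wt]

@[simp] lemma wt_cons' (i j : ι) (β : Multiset ι) : H.wt i (j ::ₘ β) = H.c i j + H.wt i β := by
  simp [wt]

lemma ev_consL (j : ι) (t : List ι →₀ ℂ) : H.ev (consL j t) = H.E j * H.ev t := by
  induction t using Finsupp.induction_linear with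
  | zero => simp
  | add f g hf hg => simp [hf, hg, mul_add]
  | single w z => simp

lemma Ki_E (i j : ι) : H.Ki i * H.E j = H.q ^ (-H.c i j) • (H.E j * H.Ki i) := by
  have h := congrArg (fun x => H.Ki i * x * H.Ki i) (H.K_E i j)
  simp only [mul_smul_comm, smul_mul_assoc] at h
  rw [← mul_assoc (H.Ki i), H.Ki_K, one_mul, ← mul_assoc (H.Ki i), mul_assoc _ (H.K i),
    H.K_Ki, mul_one] at h
  rw [h, smul_smul, ← zpow_add₀ H.q_ne]
  simp

lemma K_word (i : ι) (w : List ι) :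
    H.K i * H.word w = H.q ^ H.wt i w • (H.word w * H.K i) := by
  induction w with
  | nil => simp
  | cons j w ih =>
    rw [word_cons, ← mul_assoc, K_E, smul_mul_assoc, mul_assoc, ih, wt_cons,
      zpow_add₀ H.q_ne, mul_smul_comm, smul_smul, mul_assoc]

lemma Ki_word (i : ι) (w : List ι) :
    H.Ki i * H.word w = H.q ^ (-H.wt i w) • (H.word w * H.Ki i) := by
  induction w with
  | nil => simp
  | cons j w ih =>
    rw [word_cons, ← mul_assoc, Ki_E, smul_mul_assoc, mul_assoc, ih, wt_cons, neg_add,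
      zpow_add₀ H.q_ne, mul_smul_comm, smul_smul, mul_assoc]

lemma homog_induction {s : Set (List ι)} {p : (List ι →₀ ℂ) → Prop} (h0 : p 0)
    (hadd : ∀ f g, p f → p g → p (f + g)) (hs : ∀ w ∈ s, ∀ z, p (Finsupp.single w z))
    {t : List ι →₀ ℂ} (ht : t ∈ Finsupp.supported ℂ ℂ s) : p t := by
  rw [← Finsupp.sum_single t]
  refine Finset.sum_induction _ p hadd h0 fun w hw => hs w ?_ _
  exact (Finsupp.mem_supported ℂ t).1 ht hw

lemma K_ev (i : ι) {β : Multiset ι} {t : List ι →₀ ℂ} (ht : t ∈ homog β) :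
    H.K i * H.ev t = H.q ^ H.wt i β • (H.ev t * H.K i) := by
  refine homog_induction (p := fun t => H.K i * H.ev t = H.q ^ H.wt i β • (H.ev t * H.K i))
    (by simp) ?_ ?_ ht
  · intro f g hf hg
    simp [mul_add, add_mul, hf, hg]
  · rintro w rfl z
    simp [K_word, smul_comm z]

lemma Ki_ev (i : ι) {β : Multiset ι} {t : List ι →₀ ℂ} (ht : t ∈ homog β) :
    H.Ki i * H.ev t = H.q ^ (-H.wt i β) • (H.ev t * H.Ki i) := by
  refine homog_induction
    (p := fun t => H.Ki i * H.ev t = H.q ^ (-H.wt i β) • (H.ev t * H.Ki i)) (by simp) ?_ ?_ ht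
  · intro f g hf hg
    simp [mul_add, add_mul, hf, hg]
  · rintro w rfl z
    simp only [ev_single, mul_smul_comm, Ki_word, smul_mul_assoc]
    rw [smul_comm]

lemma word_F (i : ι) (w : List ι) :
    H.word w * H.F i - H.F i * H.word w =
      H.κ • (H.ev (H.dW i w) * H.K i - H.Ki i * H.ev (H.dW' i w)) := by
  induction w with
  | nil => simp [dW, dW']
  | cons j w ih =>
    have e1 : H.word (j :: w) * H.F i - H.F i * H.word (j :: w) =
        H.E j * (H.word w * H.F i - H.F i * H.word w) +
          (H.E j * H.F i - H.F i * H.E j) * H.word w := by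
      rw [word_cons]; noncomm_ring
    have e2 : H.E j * H.Ki i = H.q ^ H.c i j • (H.Ki i * H.E j) := by
      rw [Ki_E, smul_smul, ← zpow_add₀ H.q_ne]; simp
    rw [e1, ih, E_F, dW, dW', map_add, map_add, map_smul, ev_consL, ev_consL]
    have e3 : H.E j * (H.ev (H.dW i w) * H.K i - H.Ki i * H.ev (H.dW' i w)) =
        H.E j * H.ev (H.dW i w) * H.K i -
          H.q ^ H.c i j • (H.Ki i * (H.E j * H.ev (H.dW' i w))) := by
      rw [mul_sub, ← mul_assoc, ← mul_assoc, e2, smul_mul_assoc, mul_assoc (H.Ki i)]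
    rw [mul_smul_comm, e3]
    by_cases h : j = i
    · subst h
      simp only [if_true, ev_single, one_smul, smul_mul_assoc, sub_mul, K_word, add_mul, mul_add,
        mul_smul_comm]
      rw [← smul_add]
      congr 1
      abel
    · simp [h, Ne.symm h]

lemma ev_F (i : ι) (t : List ι →₀ ℂ) :
    H.ev t * H.F i - H.F i * H.ev t =
      H.κ • (H.ev (H.d i t) * H.K i - H.Ki i * H.ev (H.d' i t)) := by
  induction t using Finsupp.induction_linear with
  | zero => simp
  | add f g hf hg =>
    have : H.ev (f + g) * H.F i - H.F i * H.ev (f + g) =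
        (H.ev f * H.F i - H.F i * H.ev f) + (H.ev g * H.F i - H.F i * H.ev g) := by
      rw [map_add]; noncomm_ring
    rw [this, hf, hg, ← smul_add]
    simp only [map_add, add_mul, mul_add]
    congr 1
    abel
  | single w z =>
    simp only [ev_single, d_single, d'_single, map_smul, smul_mul_assoc, mul_smul_comm]
    rw [← smul_sub, word_F, ← smul_sub, smul_comm]

lemma consL_mem {s s' : Set (List ι)} (j : ι) (h : ∀ w ∈ s, j :: w ∈ s') {t : List ι →₀ ℂ}
    (ht : t ∈ Finsupp.supported ℂ ℂ s) : consL j t ∈ Finsupp.supported ℂ ℂ s' := by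
  refine homog_induction (p := fun t => consL j t ∈ Finsupp.supported ℂ ℂ s')
    (by simp) ?_ ?_ ht
  · intro f g hf hg
    rw [map_add]; exact add_mem hf hg
  · intro w hw z
    rw [consL_single]
    exact Finsupp.single_mem_supported ℂ z (h w hw)

lemma snocL_mem {s s' : Set (List ι)} (j : ι) (h : ∀ w ∈ s, w ++ [j] ∈ s') {t : List ι →₀ ℂ}
    (ht : t ∈ Finsupp.supported ℂ ℂ s) : snocL j t ∈ Finsupp.supported ℂ ℂ s' := by
  refine homog_induction (p := fun t => snocL j t ∈ Finsupp.supported ℂ ℂ s')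
    (by simp) ?_ ?_ ht
  · intro f g hf hg
    rw [map_add]; exact add_mem hf hg
  · intro w hw z
    rw [snocL_single]
    exact Finsupp.single_mem_supported ℂ z (h w hw)

lemma dW_mem (i : ι) (w : List ι) :
    H.dW i w ∈ Finsupp.supported ℂ ℂ {v : List ι | i ::ₘ (v : Multiset ι) = (w : Multiset ι)} := by
  induction w with
  | nil => simp [dW]
  | cons j w ih =>
    rw [dW]
    refine add_mem ?_ (consL_mem j ?_ ih)
    · split_ifs with h
      · exact Finsupp.single_mem_supported ℂ _ (by simp [h])
      · simp
    · intro v hv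
      simp only [Set.mem_ofPred_eq] at hv ⊢
      rw [← Multiset.cons_coe, ← Multiset.cons_coe, Multiset.cons_swap, hv]

lemma dW'_mem (i : ι) (w : List ι) :
    H.dW' i w ∈ Finsupp.supported ℂ ℂ {v : List ι | i ::ₘ (v : Multiset ι) = (w : Multiset ι)} := by
  induction w with
  | nil => simp [dW']
  | cons j w ih =>
    rw [dW']
    refine add_mem ?_ (Submodule.smul_mem _ _ (consL_mem j ?_ ih))
    · split_ifs with h
      · exact Finsupp.single_mem_supported ℂ _ (by simp [h])
      · simp
    · intro v hv
      simp only [Set.mem_ofPred_eq] at hv ⊢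
      rw [← Multiset.cons_coe, ← Multiset.cons_coe, Multiset.cons_swap, hv]

lemma d_mem (i : ι) {β : Multiset ι} {t : List ι →₀ ℂ} (ht : t ∈ homog β) :
    H.d i t ∈ Finsupp.supported ℂ ℂ {v : List ι | i ::ₘ (v : Multiset ι) = β} := by
  refine homog_induction
    (p := fun t => H.d i t ∈ Finsupp.supported ℂ ℂ {v : List ι | i ::ₘ (v : Multiset ι) = β})
    (by simp) ?_ ?_ ht
  · intro f g hf hg
    rw [map_add]; exact add_mem hf hg
  · rintro w rfl z
    rw [d_single]
    exact Submodule.smul_mem _ _ (H.dW_mem i w)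

lemma d'_mem (i : ι) {β : Multiset ι} {t : List ι →₀ ℂ} (ht : t ∈ homog β) :
    H.d' i t ∈ Finsupp.supported ℂ ℂ {v : List ι | i ::ₘ (v : Multiset ι) = β} := by
  refine homog_induction
    (p := fun t => H.d' i t ∈ Finsupp.supported ℂ ℂ {v : List ι | i ::ₘ (v : Multiset ι) = β})
    (by simp) ?_ ?_ ht
  · intro f g hf hg
    rw [map_add]; exact add_mem hf hg
  · rintro w rfl z
    rw [d'_single]
    exact Submodule.smul_mem _ _ (H.dW'_mem i w)

lemma supported_le_homog_erase (i : ι) (β : Multiset ι) :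
    Finsupp.supported ℂ ℂ {v : List ι | i ::ₘ (v : Multiset ι) = β} ≤ homog (β.erase i) := by
  refine Finsupp.supported_mono ?_
  rintro v rfl
  simp

/-- Rescaling a word by the pairing of `α_i` with its weight. -/
def scale (i : ι) : (List ι →₀ ℂ) →ₗ[ℂ] (List ι →₀ ℂ) :=
  Finsupp.linearCombination ℂ fun w => Finsupp.single w (H.q ^ H.wt i w)

lemma scale_eq (i : ι) {s : Set (List ι)} {n : ℤ} (hs : ∀ w ∈ s, H.wt i w = n)
    {t : List ι →₀ ℂ} (ht : t ∈ Finsupp.supported ℂ ℂ s) : H.scale i t = H.q ^ n • t := by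
  refine homog_induction (p := fun t => H.scale i t = H.q ^ n • t) (by simp) ?_ ?_ ht
  · intro f g hf hg
    rw [map_add, hf, hg, smul_add]
  · intro w hw z
    simp [scale, hs w hw, mul_comm]

lemma d_consL (i j : ι) (t : List ι →₀ ℂ) :
    H.d i (consL j t) = (if i = j then H.scale i t else 0) + consL j (H.d i t) := by
  induction t using Finsupp.induction_linear with
  | zero => simp
  | add f g hf hg =>
    rw [map_add, map_add, hf, hg]
    split_ifs <;> simp only [map_add] <;> abel
  | single w z =>
    rw [consL_single, d_single, dW, d_single, map_smul]
    split_ifs <;> simp [scale]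

lemma d'_consL (i j : ι) (t : List ι →₀ ℂ) :
    H.d' i (consL j t) = (if i = j then t else 0) + H.q ^ H.c i j • consL j (H.d' i t) := by
  induction t using Finsupp.induction_linear with
  | zero => simp
  | add f g hf hg =>
    rw [map_add, map_add, hf, hg]
    split_ifs <;> simp only [map_add, smul_add] <;> abel
  | single w z =>
    rw [consL_single, d'_single, dW', d'_single, map_smul, smul_add, smul_comm z]
    split_ifs <;> simp

lemma d_snocL (i j : ι) (t : List ι →₀ ℂ) :
    H.d i (snocL j t) = (if i = j then t else 0) + H.q ^ H.c i j • snocL j (H.d i t) := by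
  have comm : ∀ (k : ι) (s : List ι →₀ ℂ), snocL j (consL k s) = consL k (snocL j s) := by
    intro k s
    induction s using Finsupp.induction_linear with
    | zero => simp
    | add f g hf hg => simp only [map_add, hf, hg]
    | single w z => simp
  induction t using Finsupp.induction_linear with
  | zero => simp
  | add f g hf hg =>
    rw [map_add, map_add, hf, hg]
    split_ifs <;> simp only [map_add, smul_add] <;> abel
  | single w z =>
    have key : H.dW i (w ++ [j]) =
        (if i = j then Finsupp.single w 1 else 0) + H.q ^ H.c i j • snocL j (H.dW i w) := by
      induction w with
      | nil =>
        simp only [List.nil_append, dW]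
        split_ifs <;> simp
      | cons k w ih =>
        rw [List.cons_append, dW, ih, dW]
        have hw : H.wt i ((w ++ [j] : List ι) : Multiset ι) = H.c i j + H.wt i (w : Multiset ι) := by
          simp [wt, add_comm]
        rw [hw, zpow_add₀ H.q_ne, map_add, map_add, map_smul, comm]
        split_ifs <;> simp <;> abel
    rw [snocL_single, d_single, key, d_single, map_smul, smul_add, smul_comm z]
    split_ifs <;> simp

lemma d_d' (i k : ι) (t : List ι →₀ ℂ) : H.d i (H.d' k t) = H.d' k (H.d i t) := by
  induction t using Finsupp.induction_linear with
  | zero => simp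
  | add f g hf hg => simp only [map_add, hf, hg]
  | single w z =>
    rw [d_single, d'_single, map_smul, map_smul]
    congr 1
    induction w with
    | nil => simp [dW, dW']
    | cons j w ih =>
      have hs : H.scale i (H.dW' k w) = H.q ^ (H.wt i w - H.c i k) • H.dW' k w := by
        refine H.scale_eq i (fun v hv => ?_) (H.dW'_mem k w)
        simp only [Set.mem_ofPred_eq] at hv
        rw [← hv, wt_cons']; ring
      rw [dW, dW', map_add, map_add, map_smul, d_consL, d'_consL, ih, hs]
      have e2 : H.q ^ H.c k i * H.q ^ (H.wt i w - H.c i k) = H.q ^ H.wt i w := by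
        rw [← zpow_add₀ H.q_ne, H.c_symm k i]; congr 1; ring
      by_cases hi : i = j <;> by_cases hk : k = j
      · subst hi; subst hk
        simp only [if_true, d_single, d'_single, one_smul, smul_add, smul_smul, e2]
        abel
      · subst hi
        simp only [if_true, hk, if_false, d'_single, smul_add, smul_smul, e2, map_zero]
        abel
      · subst hk
        simp [hi]
      · simp [hi, hk]

lemma pair_mul_eq_zero {k : U} (hk : ∀ a b, H.pair k (a * b) = H.pair k a * H.pair k b)
    (w : List ι) (a b : A) (hb : ∀ v, H.pair (H.word v * k) b = 0) :
    H.pair (H.word w * k) (a * b) = 0 := by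
  induction w generalizing a b with
  | nil =>
    have := hb []
    simp only [word_nil, one_mul] at this ⊢
    rw [hk, this, mul_zero]
  | cons j w ih =>
    rw [word_cons, mul_assoc, ← H.pair_hL, hL_E_mul, map_add, ih _ _ hb, ih, add_zero]
    intro v
    rw [H.pair_hL, ← mul_assoc, ← word_cons]
    exact hb _

lemma pair_mul_of_weight {k : U} (hk : ∀ a b, H.pair k (a * b) = H.pair k a * H.pair k b)
    (w : List ι) (a b : A) (hb : ∀ v, v ≠ [] → H.pair (H.word v * k) b = 0) :
    H.pair (H.word w * k) (a * b) = H.pair k b * H.pair (H.word w * k) a := by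
  induction w generalizing a with
  | nil => simp [hk, mul_comm]
  | cons j w ih =>
    rw [word_cons, mul_assoc, ← H.pair_hL, hL_E_mul, map_add, ih, H.pair_hL,
      H.pair_mul_eq_zero hk, add_zero]
    intro v
    rw [H.pair_hL, ← mul_assoc, ← word_cons]
    exact hb _ (by simp)

lemma pair_ev_mul_of_weight {k : U} (hk : ∀ a b, H.pair k (a * b) = H.pair k a * H.pair k b)
    (t : List ι →₀ ℂ) (a b : A) (hb : ∀ v, v ≠ [] → H.pair (H.word v * k) b = 0) :
    H.pair (H.ev t * k) (a * b) = H.pair k b * H.pair (H.ev t * k) a := by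
  induction t using Finsupp.induction_linear with
  | zero => simp
  | add f g hf hg => simp [add_mul, hf, hg, mul_add]
  | single w z =>
    simp only [ev_single, smul_mul_assoc, map_smul, LinearMap.smul_apply, smul_eq_mul]
    rw [H.pair_mul_of_weight hk w a b hb]
    ring

lemma pair_K_mul (i : ι) (a b : A) :
    H.pair (H.K i) (a * b) = H.pair (H.K i) a * H.pair (H.K i) b := by
  have h : ∀ x, H.pair (H.K i) x = H.pair 1 (H.hL (H.K i) x) := fun x => by
    rw [H.pair_hL, mul_one]
  rw [h, h a, h b, hL_K_mul, H.pair_one]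

lemma pair_Ki_mul (i : ι) (a b : A) :
    H.pair (H.Ki i) (a * b) = H.pair (H.Ki i) a * H.pair (H.Ki i) b := by
  have h : ∀ x, H.pair (H.Ki i) x = H.pair 1 (H.hL (H.Ki i) x) := fun x => by
    rw [H.pair_hL, mul_one]
  rw [h, h a, h b, hL_Ki_mul, H.pair_one]

lemma exists_wt_ne_zero {β : Multiset ι} (hβ : β ≠ 0) : ∃ i, H.wt i β ≠ 0 := by
  by_contra! h
  refine H.c_pos β hβ ?_
  have : (fun i => (β.map (H.c i)).sum) = fun _ => 0 := funext h
  rw [this]; simp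

lemma pair_word_eq_zero_of_weight {k : U} (hk : ∀ j, H.K j * k = k * H.K j) (g : A)
    (hg : ∀ j, ∃ χ : ℂ, χ ≠ 0 ∧ (∀ v, H.pair (H.K j * v) g = χ * H.pair v g) ∧
      ∀ v, H.pair (v * H.K j) g = χ * H.pair v g)
    (w : List ι) (hw : w ≠ []) : H.pair (H.word w * k) g = 0 := by
  obtain ⟨j, hj⟩ := H.exists_wt_ne_zero (β := (w : Multiset ι)) (by simpa using hw)
  obtain ⟨χ, h0, hl, hr⟩ := hg j
  have h := hl (H.word w * k)
  rw [← mul_assoc, K_word, smul_mul_assoc, mul_assoc, hk, ← mul_assoc, map_smul,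
    LinearMap.smul_apply, hr, smul_eq_mul] at h
  have h2 : χ * ((H.q ^ H.wt j w - 1) * H.pair (H.word w * k) g) = 0 := by linear_combination h
  simpa [h0, sub_eq_zero, H.q_pow _ hj] using h2

lemma K_Ki_comm (i j : ι) : H.K j * H.Ki i = H.Ki i * H.K j := by
  have h := congrArg (fun x => H.Ki i * x * H.Ki i) (H.K_K i j)
  rw [← mul_assoc (H.Ki i), H.Ki_K, one_mul, ← mul_assoc (H.Ki i), mul_assoc _ (H.K i),
    H.K_Ki, mul_one] at h
  exact h

lemma ev_eq_zero_of_K (i : ι) {s s' : List ι →₀ ℂ} {μ : ℂ} (hμ : μ ≠ 0)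
    (h : H.ev s * H.K i = μ • (H.ev s' * H.Ki i)) : H.ev s = 0 ∧ H.ev s' = 0 := by
  have h1 : H.ev s * H.K i = 0 := by
    refine H.nondegU _ fun a => ?_
    have e1 := H.pair_ev_mul_of_weight (H.pair_K_mul i) s a (H.g i)
      (H.pair_word_eq_zero_of_weight (fun j => H.K_K j i) _ (H.g_wt i))
    have e2 := H.pair_ev_mul_of_weight (H.pair_Ki_mul i) s' a (H.g i)
      (H.pair_word_eq_zero_of_weight (H.K_Ki_comm i) _ (H.g_wt i))
    have e3 : ∀ b, H.pair (H.ev s * H.K i) b = μ * H.pair (H.ev s' * H.Ki i) b := fun b => by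
      rw [h]; simp
    have e4 : (H.pair (H.K i) (H.g i) - H.pair (H.Ki i) (H.g i)) *
        H.pair (H.ev s * H.K i) a = 0 := by
      linear_combination e3 (a * H.g i) - e1 + μ * e2 - H.pair (H.Ki i) (H.g i) * e3 a
    simpa [sub_eq_zero, H.g_ne i] using e4
  have h2 : H.ev s' * H.Ki i = 0 := by
    rw [h1] at h
    simpa [hμ] using h.symm
  refine ⟨?_, ?_⟩
  · have := congrArg (· * H.Ki i) h1
    simpa [mul_assoc, H.K_Ki] using this
  · have := congrArg (· * H.K i) h2
    simpa [mul_assoc, H.Ki_K] using this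

lemma ev_d_eq_zero (i : ι) {β : Multiset ι} {t : List ι →₀ ℂ} (ht : t ∈ homog β)
    (h : H.ev t = 0) : H.ev (H.d i t) = 0 ∧ H.ev (H.d' i t) = 0 := by
  have h1 := H.ev_F i t
  rw [h, zero_mul, mul_zero, sub_zero] at h1
  have h2 := (smul_eq_zero.1 h1.symm).resolve_left H.κ_ne
  rw [H.Ki_ev i (supported_le_homog_erase i β (H.d'_mem i ht)), sub_eq_zero] at h2
  exact H.ev_eq_zero_of_K i (zpow_ne_zero _ H.q_ne) h2

open scoped ComplexOrder in
lemma ev_eq_zero_of_commute {β : Multiset ι} (hβ : β ≠ 0) {t : List ι →₀ ℂ} (ht : t ∈ homog β)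
    (hF : ∀ i, H.ev t * H.F i = H.F i * H.ev t) : H.ev t = 0 := by
  refine H.rep _ fun n _ _ ρ hρ => ?_
  set Z := ρ (H.ev t) with hZ
  have hZE : ∀ i, Z * (ρ (H.E i)).conjTranspose =
      H.q ^ (-H.wt i β) • ((ρ (H.E i)).conjTranspose * Z) := by
    intro i
    have hK := H.K_ev i ht
    have : H.ev t * (H.K i * H.F i) = H.q ^ (-H.wt i β) • ((H.K i * H.F i) * H.ev t) := by
      rw [mul_assoc (H.K i), ← hF i, ← mul_assoc (H.K i), hK, smul_mul_assoc, smul_smul,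
        ← zpow_add₀ H.q_ne]
      simp [mul_assoc]
    rw [hρ, ← map_mul, hZ, mul_smul_comm, ← map_mul, this, map_smul, smul_mul_assoc, ← map_mul,
      smul_comm]
  have hZw : ∀ w : List ι, Z * (ρ (H.word w)).conjTranspose =
      H.q ^ (-(w.map fun i => H.wt i β).sum) • ((ρ (H.word w)).conjTranspose * Z) := by
    intro w
    induction w with
    | nil => simp
    | cons j w ih =>
      rw [word_cons, map_mul, Matrix.conjTranspose_mul, ← mul_assoc, ih, smul_mul_assoc,
        mul_assoc, hZE, mul_smul_comm, smul_smul, ← zpow_add₀ H.q_ne, List.map_cons,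
        List.sum_cons, neg_add, add_comm, mul_assoc]
  have hZt : ∀ s ∈ homog β, Z * (ρ (H.ev s)).conjTranspose =
      H.q ^ (-(β.map fun i => H.wt i β).sum) • ((ρ (H.ev s)).conjTranspose * Z) := by
    intro s hs
    refine homog_induction (p := fun s => Z * (ρ (H.ev s)).conjTranspose =
      H.q ^ (-(β.map fun i => H.wt i β).sum) • ((ρ (H.ev s)).conjTranspose * Z))
      (by simp) ?_ ?_ hs
    · intro f g hf hg
      simp only [map_add, Matrix.conjTranspose_add, mul_add, add_mul, hf, hg, smul_add]
    · intro w hw z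
      have hw' : (β.map fun i => H.wt i β).sum = (w.map fun i => H.wt i β).sum := by
        rw [← (show (w : Multiset ι) = β from hw)]; simp
      rw [hw', ev_single, map_smul, Matrix.conjTranspose_smul, mul_smul_comm, hZw,
        smul_mul_assoc, smul_comm]
  have h1 := congrArg Matrix.trace (hZt t ht)
  rw [← hZ, Matrix.trace_mul_comm, Matrix.trace_smul, smul_eq_mul] at h1
  have h2 : (H.q ^ (-(β.map fun i => H.wt i β).sum) - 1) *
      (Z.conjTranspose * Z).trace = 0 := by linear_combination -h1
  have h3 : H.q ^ (-(β.map fun i => H.wt i β).sum) - 1 ≠ 0 :=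
    sub_ne_zero.2 (H.q_pow _ (neg_ne_zero.2 (H.c_pos β hβ)))
  exact Matrix.trace_conjTranspose_mul_self_eq_zero_iff.1 ((mul_eq_zero.1 h2).resolve_left h3)

lemma d'_eq_zero_of_notMem {i : ι} {β : Multiset ι} (hi : i ∉ β) {t : List ι →₀ ℂ}
    (ht : t ∈ homog β) : H.d' i t = 0 := by
  have h := H.d'_mem i ht
  have : {v : List ι | i ::ₘ (v : Multiset ι) = β} = ∅ := by
    ext v
    simp only [Set.mem_ofPred_eq, Set.mem_empty_iff_false, iff_false]
    rintro rfl
    simp at hi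
  rw [this] at h
  simpa using h

lemma d_eq_zero_of_notMem {i : ι} {β : Multiset ι} (hi : i ∉ β) {t : List ι →₀ ℂ}
    (ht : t ∈ homog β) : H.d i t = 0 := by
  have h := H.d_mem i ht
  have : {v : List ι | i ::ₘ (v : Multiset ι) = β} = ∅ := by
    ext v
    simp only [Set.mem_ofPred_eq, Set.mem_empty_iff_false, iff_false]
    rintro rfl
    simp at hi
  rw [this] at h
  simpa using h

lemma d_mem_homog (i : ι) {β : Multiset ι} {t : List ι →₀ ℂ} (ht : t ∈ homog β) :
    H.d i t ∈ homog (β.erase i) := supported_le_homog_erase i β (H.d_mem i ht)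

lemma d'_mem_homog (i : ι) {β : Multiset ι} {t : List ι →₀ ℂ} (ht : t ∈ homog β) :
    H.d' i t ∈ homog (β.erase i) := supported_le_homog_erase i β (H.d'_mem i ht)

lemma ev_eq_zero_of_d' {β : Multiset ι} (hβ : β ≠ 0) {t : List ι →₀ ℂ} (ht : t ∈ homog β)
    (h : ∀ i, H.ev (H.d' i t) = 0) : H.ev t = 0 := by
  induction hn : β.card using Nat.strong_induction_on generalizing β t with
  | _ n ih =>
  have hd : ∀ i, H.ev (H.d i t) = 0 := by
    intro i
    by_cases hi : i ∈ β
    · by_cases he : β.erase i = 0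
      · have hb : β = {i} := by
          rw [← Multiset.cons_erase hi, he]; rfl
        have : H.d i t = H.d' i t := by
          subst hb
          refine homog_induction (p := fun t => H.d i t = H.d' i t) (by simp) ?_ ?_ ht
          · intro f g hf hg
            rw [map_add, map_add, hf, hg]
          · intro w hw z
            have : w = [i] := by simpa using hw
            subst this
            simp [dW, dW']
        rw [this, h]
      · refine ih (β.erase i).card ?_ he (H.d_mem_homog i ht) (fun j => ?_) rfl
        · rw [← hn]; exact Multiset.card_erase_lt_of_mem hi
        · rw [← d_d']
          exact (H.ev_d_eq_zero i (H.d'_mem_homog j ht) (h j)).1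
    · rw [H.d_eq_zero_of_notMem hi ht, map_zero]
  refine H.ev_eq_zero_of_commute hβ ht fun i => ?_
  have := H.ev_F i t
  rw [hd, h, zero_mul, mul_zero, sub_zero, smul_zero, sub_eq_zero] at this
  exact this

/-- Elements of `A` extremal for the parabolic subalgebra, homogeneous for the pairing
with words in the `E i`. -/
structure IsExt (n : ℕ) (β : Multiset ι) (x : A) : Prop where
  pair_F : ∀ i v, H.pair (H.F i * v) x = 0
  pair_E : ∀ i, i ≠ H.r → ∀ v, H.pair (H.E i * v) x = 0
  pair_K : ∀ i v, H.pair (H.K i * v) x = (if i = H.r then H.q ^ n else 1) * H.pair v x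
  pair_word : ∀ w : List ι, (w : Multiset ι) ≠ β → H.pair (H.word w) x = 0

/-- Elements of `U` orthogonal to all extremal elements. -/
def Orth (y : U) : Prop := ∀ n β x, H.IsExt n β x → H.pair y x = 0

variable {H}

lemma IsExt.chi_ne (n : ℕ) (i : ι) : (if i = H.r then H.q ^ n else 1 : ℂ) ≠ 0 := by
  split_ifs
  · exact pow_ne_zero _ H.q_ne
  · exact one_ne_zero

lemma IsExt.pair_Ki {n : ℕ} {β : Multiset ι} {x : A} (hx : H.IsExt n β x) (i : ι) (v : U) :
    H.pair (H.Ki i * v) x = (if i = H.r then H.q ^ n else 1)⁻¹ * H.pair v x := by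
  have h := hx.pair_K i (H.Ki i * v)
  rw [← mul_assoc, H.K_Ki, one_mul] at h
  rw [h, inv_mul_cancel_left₀ (IsExt.chi_ne n i)]

lemma pair_ev_eq_zero {s : Set (List ι)} {t : List ι →₀ ℂ} (ht : t ∈ Finsupp.supported ℂ ℂ s)
    {x : A} (h : ∀ w ∈ s, H.pair (H.word w) x = 0) : H.pair (H.ev t) x = 0 := by
  refine homog_induction (p := fun t => H.pair (H.ev t) x = 0) (by simp) ?_ ?_ ht
  · intro f g hf hg
    simp [hf, hg]
  · intro w hw z
    simp [h w hw]

lemma ev_mul_K (i : ι) {β : Multiset ι} {t : List ι →₀ ℂ} (ht : t ∈ homog β) :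
    H.ev t * H.K i = H.q ^ (-H.wt i β) • (H.K i * H.ev t) := by
  rw [H.K_ev i ht, smul_smul, ← zpow_add₀ H.q_ne]
  simp

lemma IsExt.hR_F {n : ℕ} {β : Multiset ι} {x : A} (hx : H.IsExt n β x) (i : ι) :
    H.IsExt n (i ::ₘ β) (H.hR (H.F i) x) where
  pair_F j v := by rw [H.pair_hR, mul_assoc, hx.pair_F]
  pair_E j hj v := by rw [H.pair_hR, mul_assoc, hx.pair_E j hj]
  pair_K j v := by rw [H.pair_hR, H.pair_hR, mul_assoc, hx.pair_K]
  pair_word w hw := by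
    have hs : (Finsupp.single w (1 : ℂ)) ∈ homog (w : Multiset ι) :=
      Finsupp.single_mem_supported ℂ _ rfl
    have e := H.ev_F i (Finsupp.single w 1)
    rw [ev_mul_K i (H.d_mem_homog i hs), ev_single, one_smul, sub_eq_iff_eq_add] at e
    have hv : ∀ v ∈ {v : List ι | i ::ₘ (v : Multiset ι) = (w : Multiset ι)},
        H.pair (H.word v) x = 0 := by
      intro v hv
      refine hx.pair_word v ?_
      rintro rfl
      exact hw hv.symm
    rw [H.pair_hR, e]
    simp only [map_add, map_smul, map_sub, LinearMap.add_apply, LinearMap.sub_apply,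
      LinearMap.smul_apply, hx.pair_F, hx.pair_K, hx.pair_Ki,
      pair_ev_eq_zero (H.d_mem i hs) hv, pair_ev_eq_zero (H.d'_mem i hs) hv]
    simp

lemma IsExt.hL_F {n : ℕ} {β : Multiset ι} {x : A} (hx : H.IsExt n β x) (i : ι) :
    H.hL (H.F i) x = 0 :=
  H.nondegA _ fun v => by rw [H.pair_hL, hx.pair_F]

lemma IsExt.hL_E {n : ℕ} {β : Multiset ι} {x : A} (hx : H.IsExt n β x) {i : ι} (hi : i ≠ H.r) :
    H.hL (H.E i) x = 0 :=
  H.nondegA _ fun v => by rw [H.pair_hL, hx.pair_E i hi]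

lemma IsExt.hL_K {n : ℕ} {β : Multiset ι} {x : A} (hx : H.IsExt n β x) (i : ι) :
    H.hL (H.K i) x = (if i = H.r then H.q ^ n else 1 : ℂ) • x :=
  sub_eq_zero.1 <| H.nondegA _ fun v => by
    rw [map_sub, H.pair_hL, hx.pair_K, map_smul, smul_eq_mul, sub_self]

lemma IsExt.m_word {w : List ι} (hw : w ≠ []) : H.pair (H.word w) H.m = 0 := by
  have := H.pair_word_eq_zero_of_weight (k := 1) (by simp) H.m (fun j =>
    ⟨if j = H.r then H.q else 1, by split_ifs; exacts [H.q_ne, one_ne_zero], H.m_KL j, H.m_KR j⟩)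
    w hw
  simpa using this

lemma IsExt.m : H.IsExt 1 0 H.m where
  pair_F i v := by rw [← H.pair_hL, H.m_F, map_zero]
  pair_E i hi v := by rw [← H.pair_hL, H.m_E i hi, map_zero]
  pair_K i v := by rw [pow_one]; exact H.m_KL i v
  pair_word w hw := IsExt.m_word (by simpa using hw)

lemma IsExt.pair_mul_m (x : A) (w : List ι) :
    H.pair (H.word w) (x * H.m) = H.pair (H.word w) x := by
  have := H.pair_mul_of_weight (k := 1) H.pair_one w x H.m
    (fun v hv => by rw [mul_one]; exact IsExt.m_word hv)
  simpa [H.m_one] using this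

lemma IsExt.mul_m {n : ℕ} {β : Multiset ι} {x : A} (hx : H.IsExt n β x) :
    H.IsExt (n + 1) β (x * H.m) where
  pair_F i v := by rw [← H.pair_hL, hL_F_mul, hx.hL_F, H.m_F, mul_zero, zero_mul, add_zero,
    map_zero]
  pair_E i hi v := by
    rw [← H.pair_hL, hL_E_mul, hx.hL_E hi, H.m_E i hi, mul_zero, zero_mul, add_zero, map_zero]
  pair_K i v := by
    rw [← H.pair_hL, hL_K_mul, hx.hL_K, IsExt.m.hL_K]
    split_ifs
    · simp only [smul_mul_assoc, mul_smul_comm, smul_smul, map_smul, smul_eq_mul]; ring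
    · simp
  pair_word w hw := by rw [IsExt.pair_mul_m, hx.pair_word w hw]

lemma IsExt.pair_ev_mul_m (x : A) (t : List ι →₀ ℂ) :
    H.pair (H.ev t) (x * H.m) = H.pair (H.ev t) x := by
  induction t using Finsupp.induction_linear with
  | zero => simp
  | add f g hf hg => simp [hf, hg]
  | single w z => simp [IsExt.pair_mul_m]

lemma Orth.ev_eq_zero {β : Multiset ι} {b : List ι →₀ ℂ} (hb : b ∈ homog β)
    (hd : ∀ i, i ≠ H.r → H.d i b = 0) (h : H.Orth (H.ev b)) : H.ev b = 0 := by
  induction hn : β.card using Nat.strong_induction_on generalizing β b with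
  | _ n ih =>
  have hmain : ∀ i, H.Orth (H.ev (H.d' i b)) := by
    intro i n β' x hx
    have key : ∀ n x, H.IsExt n β' x →
        H.pair (H.ev (H.d i b) * H.K i) x - H.pair (H.Ki i * H.ev (H.d' i b)) x = 0 := by
      intro n x hx
      have h1 : H.pair (H.ev b * H.F i) x = 0 := by
        rw [← H.pair_hR]; exact h _ _ _ (hx.hR_F i)
      have h2 := congrArg (fun y => H.pair y x) (H.ev_F i b)
      simp only [map_sub, map_smul, LinearMap.sub_apply, LinearMap.smul_apply, h1, hx.pair_F,
        smul_eq_mul, sub_zero] at h2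
      exact (mul_eq_zero.1 h2.symm).resolve_left H.κ_ne
    by_cases hi : i = H.r
    · subst hi
      have k1 := key n x hx
      have k2 := key (n + 1) _ hx.mul_m
      rw [ev_mul_K H.r (H.d_mem_homog H.r hb), map_smul, LinearMap.smul_apply] at k1 k2
      rw [hx.pair_K, hx.pair_Ki] at k1
      rw [hx.mul_m.pair_K, hx.mul_m.pair_Ki, IsExt.pair_ev_mul_m, IsExt.pair_ev_mul_m] at k2
      simp only [if_true, smul_eq_mul] at k1 k2
      have hq := H.q_ne
      have k3 : (H.q ^ (2 : ℤ) - 1) * H.pair (H.ev (H.d' H.r b)) x = 0 := by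
        have : (H.q ^ (n + 1))⁻¹ = (H.q ^ n)⁻¹ * H.q⁻¹ := by rw [pow_succ, mul_inv]
        rw [this, pow_succ] at k2
        have hn : (H.q ^ n) * (H.q ^ n)⁻¹ = 1 := mul_inv_cancel₀ (pow_ne_zero _ hq)
        have hqq : H.q * H.q⁻¹ = 1 := mul_inv_cancel₀ hq
        have h2 : H.q ^ (2 : ℤ) = H.q * H.q := by rw [zpow_ofNat, pow_two]
        rw [h2]
        linear_combination (-(H.q ^ n) * H.q * H.q) * k1 + (H.q ^ n) * H.q * k2 +
          (-H.q * H.q + 1) * H.pair (H.ev (H.d' H.r b)) x * hn +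
          (H.q ^ n) * (H.q ^ n)⁻¹ * H.pair (H.ev (H.d' H.r b)) x * hqq
      exact (mul_eq_zero.1 k3).resolve_left (sub_ne_zero.2 (H.q_pow 2 (by norm_num)))
    · have k := key n x hx
      rw [hd i hi, map_zero, zero_mul, map_zero, LinearMap.zero_apply, zero_sub, neg_eq_zero,
        hx.pair_Ki] at k
      exact (mul_eq_zero.1 k).resolve_left (inv_ne_zero (IsExt.chi_ne n i))
  by_cases hβ : β = 0
  · subst hβ
    have hp : H.ev b = b [] • 1 := by
      refine homog_induction (p := fun b => H.ev b = b [] • 1) (by simp) ?_ ?_ hb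
      · intro f g hf hg
        rw [map_add, hf, hg, Finsupp.add_apply, add_smul]
      · intro w hw z
        have : w = [] := by simpa using hw
        subst this
        simp
    have h1 := h 1 0 H.m IsExt.m
    rw [hp, map_smul, LinearMap.smul_apply, H.m_one, smul_eq_mul, mul_one] at h1
    rw [hp, h1, zero_smul]
  · refine H.ev_eq_zero_of_d' hβ hb fun i => ?_
    by_cases hi : i ∈ β
    · refine ih (β.erase i).card ?_ (H.d'_mem_homog i hb) (fun j hj => ?_) (hmain i) rfl
      · rw [← hn]; exact Multiset.card_erase_lt_of_mem hi
      · rw [d_d', hd j hj, map_zero]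
    · rw [H.d'_eq_zero_of_notMem hi hb, map_zero]

/-- Noncommutative polynomials of weight `β` all of whose words start with a letter
different from `r`. -/
def lead (r : ι) (β : Multiset ι) : Submodule ℂ (List ι →₀ ℂ) :=
  Finsupp.supported ℂ ℂ {v | (∃ j w, j ≠ r ∧ v = j :: w) ∧ (v : Multiset ι) = β}

lemma snocL_homog (i : ι) {β : Multiset ι} {t : List ι →₀ ℂ} (ht : t ∈ homog β) :
    snocL i t ∈ homog (i ::ₘ β) := by
  refine snocL_mem i ?_ ht
  rintro w rfl
  rw [Set.mem_ofPred_eq, Multiset.cons_coe, Multiset.coe_eq_coe]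
  exact List.perm_append_singleton i w

lemma snocL_lead {r : ι} (i : ι) {β : Multiset ι} {t : List ι →₀ ℂ} (ht : t ∈ lead r β) :
    snocL i t ∈ lead r (i ::ₘ β) := by
  refine snocL_mem i ?_ ht
  rintro v ⟨⟨j, w, hj, rfl⟩, rfl⟩
  refine ⟨⟨j, w ++ [i], hj, rfl⟩, ?_⟩
  rw [Multiset.cons_coe, Multiset.coe_eq_coe]
  exact List.perm_append_singleton i (j :: w)

lemma exists_lead_word (w : List ι) : ∃ b ∈ homog (w : Multiset ι),
    (∀ i, i ≠ H.r → H.d i b = 0) ∧ Finsupp.single w 1 - b ∈ lead H.r (w : Multiset ι) := by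
  induction w using List.reverseRecOn with
  | nil =>
    exact ⟨Finsupp.single [] 1, Finsupp.single_mem_supported ℂ _ rfl, fun i _ => by simp [dW],
      by simp⟩
  | append_singleton w i ih =>
    obtain ⟨b, hb, hd, hl⟩ := ih
    have hw : ((w ++ [i] : List ι) : Multiset ι) = i ::ₘ (w : Multiset ι) := by
      rw [Multiset.cons_coe, Multiset.coe_eq_coe]
      exact List.perm_append_singleton i w
    rw [hw]
    have hs := snocL_lead i hl
    rw [map_sub, snocL_single] at hs
    by_cases hi : i = H.r
    · refine ⟨snocL i b, snocL_homog i hb, fun k hk => ?_, hs⟩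
      rw [d_snocL, hd k hk, if_neg (by rintro rfl; exact hk hi)]
      simp
    · have hc : consL i b ∈ lead H.r (i ::ₘ (w : Multiset ι)) := by
        refine consL_mem i ?_ hb
        intro v hv
        exact ⟨⟨i, v, hi, rfl⟩, by rw [← Multiset.cons_coe, show (v : Multiset ι) = w from hv]⟩
      have hc' : consL i b ∈ homog (i ::ₘ (w : Multiset ι)) :=
        Finsupp.supported_mono (fun v hv => hv.2) hc
      refine ⟨snocL i b - H.q ^ (-H.wt i w) • consL i b,
        sub_mem (snocL_homog i hb) (Submodule.smul_mem _ _ hc'), fun k hk => ?_, ?_⟩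
      · have hsc : H.scale k b = H.q ^ H.wt k w • b :=
          H.scale_eq k (fun v hv => by rw [show (v : Multiset ι) = w from hv]) hb
        rw [map_sub, map_smul, d_snocL, d_consL, hd k hk, hsc]
        by_cases hki : k = i
        · subst hki
          simp [smul_smul, zpow_ne_zero _ H.q_ne]
        · simp [hki]
      · rw [sub_sub_eq_add_sub, add_sub_right_comm]
        exact add_mem hs (Submodule.smul_mem _ _ hc)

lemma exists_lead {β : Multiset ι} {t : List ι →₀ ℂ} (ht : t ∈ homog β) : ∃ b ∈ homog β,
    (∀ i, i ≠ H.r → H.d i b = 0) ∧ t - b ∈ lead H.r β := by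
  refine homog_induction (p := fun t => ∃ b ∈ homog β,
    (∀ i, i ≠ H.r → H.d i b = 0) ∧ t - b ∈ lead H.r β) ?_ ?_ ?_ ht
  · exact ⟨0, zero_mem _, by simp, by simp⟩
  · rintro f g ⟨b, hb, hd, hl⟩ ⟨b', hb', hd', hl'⟩
    refine ⟨b + b', add_mem hb hb', fun i hi => by rw [map_add, hd i hi, hd' i hi, add_zero], ?_⟩
    rw [add_sub_add_comm]
    exact add_mem hl hl'
  · rintro w rfl z
    obtain ⟨b, hb, hd, hl⟩ := exists_lead_word (H := H) w
    refine ⟨z • b, Submodule.smul_mem _ _ hb, fun i hi => by simp [hd i hi], ?_⟩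
    have : Finsupp.single w z = z • Finsupp.single w (1 : ℂ) := by simp
    rw [this, ← smul_sub]
    exact Submodule.smul_mem _ _ hl

variable (H) in
/-- Span of the words starting with a letter different from `r` and with length satisfying
`M`. -/
def leadSpan (M : ℕ → Prop) : Submodule ℂ U :=
  Submodule.span ℂ {x | ∃ j w, j ≠ H.r ∧ M (w.length + 1) ∧ x = H.E j * H.word w}

lemma Orth.mem_leadSpan_of_homog {β : Multiset ι} {t : List ι →₀ ℂ} (ht : t ∈ homog β)
    {M : ℕ → Prop}
    (hM : M β.card) (h : H.Orth (H.ev t)) : H.ev t ∈ H.leadSpan M := by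
  obtain ⟨b, hb, hd, hl⟩ := exists_lead (H := H) ht
  have h0 : H.ev b = 0 := by
    refine Orth.ev_eq_zero hb hd fun n β' x hx => ?_
    have : H.pair (H.ev (t - b)) x = 0 := by
      refine pair_ev_eq_zero hl ?_
      rintro v ⟨⟨j, w, hj, rfl⟩, -⟩
      rw [word_cons]
      exact hx.pair_E j hj _
    rw [map_sub, map_sub, LinearMap.sub_apply, h n β' x hx, zero_sub, neg_eq_zero] at this
    exact this
  have h1 : H.ev t = H.ev (t - b) := by rw [map_sub, h0, sub_zero]
  rw [h1]
  refine homog_induction (p := fun s => H.ev s ∈ H.leadSpan M) ?_ ?_ ?_ hl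
  · simp
  · intro f g hf hg
    rw [map_add]; exact add_mem hf hg
  · rintro v ⟨⟨j, w, hj, rfl⟩, rfl⟩ z
    rw [ev_single]
    exact Submodule.smul_mem _ _ (Submodule.subset_span ⟨j, w, hj, by simpa using hM, word_cons H j w⟩)

lemma Orth.mem_leadSpan {M : ℕ → Prop} {t : List ι →₀ ℂ}
    (ht : ∀ w ∈ t.support, M w.length) (h : H.Orth (H.ev t)) : H.ev t ∈ H.leadSpan M := by
  classical
  have hsum : t = ∑ β ∈ t.support.image (fun w : List ι => (w : Multiset ι)),
      t.filter (fun w : List ι => (w : Multiset ι) = β) := by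
    ext w
    rw [Finsupp.finsetSum_apply]
    simp only [Finsupp.filter_apply]
    rw [Finset.sum_ite_eq]
    split_ifs with hw
    · rfl
    · by_contra hne
      exact hw (Finset.mem_image_of_mem _ (Finsupp.mem_support_iff.2 hne))
  rw [hsum, map_sum]
  refine Submodule.sum_mem _ fun β hβ => ?_
  obtain ⟨w, hw, rfl⟩ := Finset.mem_image.1 hβ
  have hmem : ∀ β : Multiset ι, t.filter (fun w : List ι => (w : Multiset ι) = β) ∈ homog β := by
    intro β
    rw [homog, Finsupp.mem_supported]
    intro v hv
    rw [Finset.mem_coe, Finsupp.support_filter] at hv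
    exact (Finset.mem_filter.1 hv).2
  refine Orth.mem_leadSpan_of_homog (hmem _) (by simpa using ht w hw) fun n β' x hx => ?_
  by_cases hβ' : (w : Multiset ι) = β'
  · subst hβ'
    have h1 := h n _ x hx
    have h2 : t = t.filter (fun v : List ι => (v : Multiset ι) = w) +
        t.filter (fun v : List ι => ¬ (v : Multiset ι) = w) := (Finsupp.filter_add_filter_not _ _).symm
    have h3 : H.pair (H.ev (t.filter (fun v : List ι => ¬ (v : Multiset ι) = w))) x = 0 := by
      refine pair_ev_eq_zero (s := {v : List ι | (v : Multiset ι) ≠ w}) ?_ fun v hv => hx.pair_word v hv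
      rw [Finsupp.mem_supported]
      intro v hv
      rw [Finset.mem_coe, Finsupp.support_filter] at hv
      exact (Finset.mem_filter.1 hv).2
    rw [h2, map_add, map_add, LinearMap.add_apply, h3, add_zero] at h1
    exact h1
  · refine pair_ev_eq_zero (hmem _) fun v hv => hx.pair_word v ?_
    rw [show (v : Multiset ι) = w from hv]
    exact hβ'

variable (H) in
lemma pair_word_mul_of_length {m : ℕ} {x : A} (hK : ∀ j, ∃ χ : ℂ, ∀ v,
    H.pair (H.K j * v) x = χ * H.pair v x)
    (hx : ∀ w : List ι, w.length ≠ m → H.pair (H.word w) x = 0) (w : List ι) (hw : w.length ≤ m)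
    (a : A) : H.pair (H.word w) (x * a) = H.pair (H.word w) x * H.pair 1 a := by
  induction w generalizing m x a with
  | nil => simp [H.pair_one]
  | cons j w ih =>
    obtain ⟨χ, hχ⟩ := hK j
    have h0 : H.hL (H.K j) x = χ • x := sub_eq_zero.1 <| H.nondegA _ fun v => by
      rw [map_sub, H.pair_hL, hχ, map_smul, smul_eq_mul, sub_self]
    rw [List.length_cons] at hw
    rw [word_cons, ← H.pair_hL, hL_E_mul, map_add, h0, smul_mul_assoc, map_smul,
      ih hK hx (by omega), hx w (by omega), ih (m := m - 1) _ _ (by omega), H.pair_hL]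
    · simp
    · intro k
      obtain ⟨χ', hχ'⟩ := hK k
      refine ⟨H.q ^ (-H.c k j) * χ', fun v => ?_⟩
      have : H.E j * H.K k = H.q ^ (-H.c k j) • (H.K k * H.E j) := by
        rw [K_E, smul_smul, ← zpow_add₀ H.q_ne]; simp
      rw [H.pair_hL, ← mul_assoc, this, smul_mul_assoc, mul_assoc, map_smul, LinearMap.smul_apply,
        hχ', H.pair_hL, smul_eq_mul, mul_assoc]
    · intro v hv
      rw [H.pair_hL, ← word_cons]
      exact hx _ (by rw [List.length_cons]; omega)

lemma IsExt.pair_word_mul {n : ℕ} {β : Multiset ι} {x : A} (hx : H.IsExt n β x) (w : List ι)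
    (hw : w.length ≤ β.card) (a : A) :
    H.pair (H.word w) (x * a) = H.pair (H.word w) x * H.pair 1 a := by
  refine H.pair_word_mul_of_length (m := β.card) (fun j => ⟨_, hx.pair_K j⟩) (fun v hv => ?_) w hw a
  refine hx.pair_word v ?_
  rintro rfl
  simp at hv

lemma IsExt.exists_add {n : ℕ} {β : Multiset ι} {x : A} (hx : H.IsExt n β x) (k : ℕ) :
    ∃ y, H.IsExt (n + k) β y ∧ ∀ t, H.pair (H.ev t) y = H.pair (H.ev t) x := by
  induction k with
  | zero => exact ⟨x, hx, fun _ => rfl⟩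
  | succ k ih =>
    obtain ⟨y, hy, h⟩ := ih
    exact ⟨_, hy.mul_m, fun t => by rw [IsExt.pair_ev_mul_m, h]⟩

end QuantumHalf

namespace QslnFun

variable {q : ℝ} {N : ℕ} {D : UqslData q N} (P : QslnFun q N D)

/-- For `k : U`, the operator `a ↦ a₍₁₎ ⟨k, a₍₂₎⟩` on `A`. -/
def hitR (k : D.U) : P.A →ₗ[ℂ] P.A :=
  TensorProduct.lift ((LinearMap.lsmul ℂ P.A).flip.compl₂ (P.pair k)) ∘ₗ
    Coalgebra.comul (R := ℂ)

lemma pair_hitL (k v : D.U) (a : P.A) : P.pair v (P.hitL k a) = P.pair (k * v) a := by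
  rw [P.pair_mulU, hitL, LinearMap.comp_apply]
  generalize Coalgebra.comul (R := ℂ) a = T
  induction T using TensorProduct.induction_on with
  | zero => simp
  | tmul x y => simp
  | add x y hx hy => simp only [map_add, hx, hy]

lemma pair_hitR (k v : D.U) (a : P.A) : P.pair v (P.hitR k a) = P.pair (v * k) a := by
  rw [P.pair_mulU, hitR, LinearMap.comp_apply]
  generalize Coalgebra.comul (R := ℂ) a = T
  induction T using TensorProduct.induction_on with
  | zero => simp
  | tmul x y => simp [mul_comm]
  | add x y hx hy => simp only [map_add, hx, hy]

/-- The pairing of `U ⊗ U` with a pair of elements of `A`. -/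
def pair₂ (a b : P.A) : D.U ⊗[ℂ] D.U →ₗ[ℂ] ℂ :=
  LinearMap.mul' ℂ ℂ ∘ₗ TensorProduct.map (P.pair.flip a) (P.pair.flip b)

lemma pair₂_tmul_mul (a b : P.A) (x y : D.U) (T : D.U ⊗[ℂ] D.U) :
    P.pair₂ a b (x ⊗ₜ y * T) = P.pair₂ (P.hitL x a) (P.hitL y b) T := by
  induction T using TensorProduct.induction_on with
  | zero => simp
  | tmul z w => simp [pair₂, pair_hitL]
  | add z w hz hw => simp only [mul_add, map_add, hz, hw]

lemma pair₂_mul_tmul (a b : P.A) (x y : D.U) (T : D.U ⊗[ℂ] D.U) :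
    P.pair₂ a b (T * x ⊗ₜ y) = P.pair₂ (P.hitR x a) (P.hitR y b) T := by
  induction T using TensorProduct.induction_on with
  | zero => simp
  | tmul z w => simp [pair₂, pair_hitR]
  | add z w hz hw => simp only [add_mul, map_add, hz, hw]

lemma pair_mul_eq (x : D.U) (a b : P.A) :
    P.pair x (a * b) = P.pair₂ a b (Coalgebra.comul (R := ℂ) x) := by
  rw [P.pair_mulA]; rfl

lemma eq_of_pair {a b : P.A} (h : ∀ v, P.pair v a = P.pair v b) : a = b :=
  sub_eq_zero.1 <| P.nondegA _ fun v => by rw [map_sub, h, sub_self]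

lemma hitL_one_left (a : P.A) : P.hitL 1 a = a := P.eq_of_pair fun v => by
  rw [pair_hitL, one_mul]

lemma hitL_mul_left (x y : D.U) (a : P.A) : P.hitL (x * y) a = P.hitL y (P.hitL x a) :=
  P.eq_of_pair fun v => by simp only [pair_hitL, mul_assoc]

lemma hitL_add_left (x y : D.U) (a : P.A) : P.hitL (x + y) a = P.hitL x a + P.hitL y a :=
  P.eq_of_pair fun v => by simp only [pair_hitL, add_mul, map_add, LinearMap.add_apply]

lemma hitL_sub_left (x y : D.U) (a : P.A) : P.hitL (x - y) a = P.hitL x a - P.hitL y a :=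
  P.eq_of_pair fun v => by simp only [pair_hitL, sub_mul, map_sub, LinearMap.sub_apply]

lemma hitL_smul_left (z : ℂ) (x : D.U) (a : P.A) : P.hitL (z • x) a = z • P.hitL x a :=
  P.eq_of_pair fun v => by simp [pair_hitL]

lemma hitL_algebraMap (z : ℂ) (a : P.A) : P.hitL (algebraMap ℂ D.U z) a = z • a := by
  rw [Algebra.algebraMap_eq_smul_one, hitL_smul_left, hitL_one_left]

variable {l : ℕ} (hl : l ∈ Finset.Icc 1 (N - 1))
include hl

lemma hitL_E_mul (a b : P.A) :
    P.hitL (D.E l) (a * b) = P.hitL (D.E l) a * b + P.hitL (D.Kg l) a * P.hitL (D.E l) b :=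
  P.eq_of_pair fun v => by
    rw [pair_hitL, pair_mul_eq, Bialgebra.comul_mul, D.comul_E l hl, add_mul, map_add,
      pair₂_tmul_mul, pair₂_tmul_mul, hitL_one_left, map_add, pair_mul_eq, pair_mul_eq]

lemma hitL_F_mul (a b : P.A) :
    P.hitL (D.F l) (a * b) = P.hitL (D.F l) a * P.hitL (D.Ki l) b + a * P.hitL (D.F l) b :=
  P.eq_of_pair fun v => by
    rw [pair_hitL, pair_mul_eq, Bialgebra.comul_mul, D.comul_F l hl, add_mul, map_add,
      pair₂_tmul_mul, pair₂_tmul_mul, hitL_one_left, map_add, pair_mul_eq, pair_mul_eq]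

lemma hitL_Kg_mul (a b : P.A) :
    P.hitL (D.Kg l) (a * b) = P.hitL (D.Kg l) a * P.hitL (D.Kg l) b :=
  P.eq_of_pair fun v => by
    rw [pair_hitL, pair_mul_eq, Bialgebra.comul_mul, D.comul_Kg l hl, pair₂_tmul_mul, pair_mul_eq]

lemma hitL_Ki_mul (a b : P.A) :
    P.hitL (D.Ki l) (a * b) = P.hitL (D.Ki l) a * P.hitL (D.Ki l) b :=
  P.eq_of_pair fun v => by
    rw [pair_hitL, pair_mul_eq, Bialgebra.comul_mul, D.comul_Ki l hl, pair₂_tmul_mul, pair_mul_eq]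

lemma hitR_Kg_mul (a b : P.A) :
    P.hitR (D.Kg l) (a * b) = P.hitR (D.Kg l) a * P.hitR (D.Kg l) b :=
  P.eq_of_pair fun v => by
    rw [pair_hitR, pair_mul_eq, Bialgebra.comul_mul, D.comul_Kg l hl, pair₂_mul_tmul, pair_mul_eq]


omit hl in
lemma hitL_one_right (x : D.U) : P.hitL x 1 = Coalgebra.counit (R := ℂ) x • 1 :=
  P.eq_of_pair fun v => by
    rw [pair_hitL, map_smul, P.pair_oneA, P.pair_oneA, Bialgebra.counit_mul, smul_eq_mul]

omit hl in
lemma hitR_one_right (x : D.U) : P.hitR x 1 = Coalgebra.counit (R := ℂ) x • 1 :=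
  P.eq_of_pair fun v => by
    rw [pair_hitR, map_smul, P.pair_oneA, P.pair_oneA, Bialgebra.counit_mul, smul_eq_mul, mul_comm]

omit hl in
lemma pair_one_mul (a b : P.A) : P.pair 1 (a * b) = P.pair 1 a * P.pair 1 b := by
  rw [pair_mul_eq, Bialgebra.comul_one, Algebra.TensorProduct.one_def]
  simp [pair₂]

/-- The eigenvalue of `K_l` on the `i`-th basis vector of the vector representation. -/
def chi (q : ℝ) (l i : ℕ) : ℂ := if i = l then (q : ℂ) else if i = l + 1 then (q : ℂ)⁻¹ else 1

variable {i j : ℕ} (hi : i ∈ Finset.Icc 1 N) (hj : j ∈ Finset.Icc 1 N)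
include hi hj

omit hl in
lemma hitL_u (x : D.U) : P.hitL x (P.u i j) =
    ∑ k ∈ Finset.Icc 1 N, P.pair x (P.u i k) • P.u k j := by
  rw [hitL, LinearMap.comp_apply, P.comul_u i hi j hj, map_sum]
  simp

omit hl in
lemma hitR_u (x : D.U) : P.hitR x (P.u i j) =
    ∑ k ∈ Finset.Icc 1 N, P.pair x (P.u k j) • P.u i k := by
  rw [hitR, LinearMap.comp_apply, P.comul_u i hi j hj, map_sum]
  simp

lemma hitL_E_u : P.hitL (D.E l) (P.u i j) = if i = l then P.u (l + 1) j else 0 := by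
  have h1 := Finset.mem_Icc.1 hl
  rw [P.hitL_u hi hj, Finset.sum_congr rfl fun k hk => by rw [P.pair_E l hl i hi k hk]]
  by_cases h : i = l
  · simp only [h, true_and, ite_smul, one_smul, zero_smul, Finset.sum_ite_eq', if_true]
    rw [if_pos (Finset.mem_Icc.2 ⟨by omega, by omega⟩)]
  · simp [h]

lemma hitL_F_u : P.hitL (D.F l) (P.u i j) = if i = l + 1 then P.u l j else 0 := by
  have h1 := Finset.mem_Icc.1 hl
  rw [P.hitL_u hi hj, Finset.sum_congr rfl fun k hk => by rw [P.pair_F l hl i hi k hk]]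
  by_cases h : i = l + 1
  · simp only [h, true_and, ite_smul, one_smul, zero_smul, Finset.sum_ite_eq', if_true]
    rw [if_pos (Finset.mem_Icc.2 ⟨by omega, by omega⟩)]
  · simp [h]

lemma hitL_Kg_u : P.hitL (D.Kg l) (P.u i j) = chi q l i • P.u i j := by
  rw [P.hitL_u hi hj, Finset.sum_congr rfl fun k hk => by rw [P.pair_Kg l hl i hi k hk]]
  simp only [ite_smul, zero_smul, Finset.sum_ite_eq, if_pos hi, chi]

omit hl hi hj in
lemma chi_inv (q : ℝ) (l i : ℕ) : (chi q l i)⁻¹ =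
    if i = l then (q : ℂ)⁻¹ else if i = l + 1 then (q : ℂ) else 1 := by
  unfold chi
  split_ifs <;> simp

lemma hitL_Ki_u : P.hitL (D.Ki l) (P.u i j) = (chi q l i)⁻¹ • P.u i j := by
  rw [P.hitL_u hi hj, Finset.sum_congr rfl fun k hk => by rw [P.pair_Ki l hl i hi k hk], chi_inv]
  simp only [ite_smul, zero_smul, Finset.sum_ite_eq, if_pos hi]

lemma hitR_Kg_u : P.hitR (D.Kg l) (P.u i j) = chi q l j • P.u i j := by
  rw [P.hitR_u hi hj, Finset.sum_congr rfl fun k hk => by rw [P.pair_Kg l hl k hk j hj]]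
  rw [Finset.sum_eq_single_of_mem j hj (fun k _ hk => by simp [hk])]
  simp [chi]

lemma hitR_Ki_u : P.hitR (D.Ki l) (P.u i j) = (chi q l j)⁻¹ • P.u i j := by
  rw [P.hitR_u hi hj, Finset.sum_congr rfl fun k hk => by rw [P.pair_Ki l hl k hk j hj], chi_inv]
  rw [Finset.sum_eq_single_of_mem j hj (fun k _ hk => by simp [hk])]
  simp

end QslnFun

namespace QslnFun

variable {q : ℝ} {N : ℕ} {D : UqslData q N} (P : QslnFun q N D)

/-- The number of elements of `S` smaller than `i`. -/
def inv (S : Finset ℕ) (i : ℕ) : ℕ := (S.filter (· < i)).card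

/-- Quantum minors with rows `S` and columns `J`. -/
def minor : List ℕ → Finset ℕ → P.A
  | [], S => if S = ∅ then 1 else 0
  | j :: J, S => ∑ i ∈ S, (-(q : ℂ)) ^ inv S i • (P.u i j * minor J (S.erase i))

lemma inv_swap {S : Finset ℕ} {a b i : ℕ} (ha : a ∈ S) (hb : b ∉ S) (h : a < i ↔ b < i) :
    inv (insert b (S.erase a)) i = inv S i := by
  unfold inv
  rw [Finset.filter_insert, Finset.filter_erase]
  by_cases hi : a < i
  · rw [if_pos (h.1 hi), Finset.card_insert_of_notMem (by simp [hb]),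
      Finset.card_erase_add_one (by simp [ha, hi])]
  · rw [if_neg (fun hc => hi (h.2 hc)), Finset.erase_eq_of_notMem (by simp [hi])]

lemma insert_erase_erase {S : Finset ℕ} {a b i : ℕ} (hi : i ≠ b) :
    insert b ((S.erase i).erase a) = (insert b (S.erase a)).erase i := by
  ext x
  simp only [Finset.mem_insert, Finset.mem_erase]
  constructor
  · rintro (rfl | ⟨h1, h2, h3⟩)
    · exact ⟨hi.symm, Or.inl rfl⟩
    · exact ⟨h2, Or.inr ⟨h1, h3⟩⟩
  · rintro ⟨h1, rfl | ⟨h2, h3⟩⟩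
    · exact Or.inl rfl
    · exact Or.inr ⟨h2, h1, h3⟩

variable {l : ℕ} (hl : l ∈ Finset.Icc 1 (N - 1))

include hl in
lemma hitL_Ki_of_hitL_Kg {a : P.A} {χ : ℂ} (hχ : χ ≠ 0) (h : P.hitL (D.Kg l) a = χ • a) :
    P.hitL (D.Ki l) a = χ⁻¹ • a := by
  have h1 : P.hitL (D.Ki l) (P.hitL (D.Kg l) a) = a := by
    rw [← hitL_mul_left, (D.rels.1 l hl).1, hitL_one_left]
  rw [h, map_smul] at h1
  rw [← h1, smul_smul, inv_mul_cancel₀ hχ, one_smul, h1]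

lemma chi_ne (hq : q ≠ 0) (l i : ℕ) : chi q l i ≠ 0 := by
  have : (q : ℂ) ≠ 0 := by exact_mod_cast hq
  unfold chi
  split_ifs <;> simp [this]

variable {J : List ℕ} (hJ : ∀ j ∈ J, j ∈ Finset.Icc 1 N) {S : Finset ℕ} (hS : S ⊆ Finset.Icc 1 N)
include hl hJ hS

lemma hitL_Kg_minor : P.hitL (D.Kg l) (P.minor J S) = (∏ s ∈ S, chi q l s) • P.minor J S := by
  induction J generalizing S with
  | nil =>
    rw [minor]
    split_ifs with h
    · rw [hitL_one_right, D.counit_Kg l hl, h]; simp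
    · simp
  | cons j J ih =>
    rw [minor, map_sum, Finset.smul_sum]
    refine Finset.sum_congr rfl fun i hi => ?_
    rw [map_smul, P.hitL_Kg_mul hl, P.hitL_Kg_u hl (hS hi) (hJ j (by simp)),
      ih (fun k hk => hJ k (by simp [hk])) ((Finset.erase_subset _ _).trans hS),
      ← Finset.mul_prod_erase S _ hi, smul_mul_smul_comm, smul_comm]

lemma hitR_Kg_minor : P.hitR (D.Kg l) (P.minor J S) = (J.map (chi q l)).prod • P.minor J S := by
  induction J generalizing S with
  | nil =>
    rw [minor]
    split_ifs with h
    · rw [hitR_one_right, D.counit_Kg l hl]; simp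
    · simp
  | cons j J ih =>
    rw [minor, map_sum, Finset.smul_sum]
    refine Finset.sum_congr rfl fun i hi => ?_
    rw [map_smul, P.hitR_Kg_mul hl, P.hitR_Kg_u hl (hS hi) (hJ j (by simp)),
      ih (fun k hk => hJ k (by simp [hk])) ((Finset.erase_subset _ _).trans hS),
      List.map_cons, List.prod_cons, smul_mul_smul_comm, smul_comm]

lemma hitL_E_minor_of_notMem (h : l ∉ S) : P.hitL (D.E l) (P.minor J S) = 0 := by
  induction J generalizing S with
  | nil =>
    rw [minor]
    split_ifs
    · rw [hitL_one_right, D.counit_E l hl, zero_smul]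
    · simp
  | cons j J ih =>
    rw [minor, map_sum]
    refine Finset.sum_eq_zero fun i hi => ?_
    rw [map_smul, P.hitL_E_mul hl, P.hitL_E_u hl (hS hi) (hJ j (by simp)),
      ih (fun k hk => hJ k (by simp [hk])) ((Finset.erase_subset _ _).trans hS) (by simp [h]),
      if_neg (by rintro rfl; exact h hi)]
    simp

lemma hitL_F_minor_of_notMem (h : l + 1 ∉ S) : P.hitL (D.F l) (P.minor J S) = 0 := by
  induction J generalizing S with
  | nil =>
    rw [minor]
    split_ifs
    · rw [hitL_one_right, D.counit_F l hl, zero_smul]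
    · simp
  | cons j J ih =>
    rw [minor, map_sum]
    refine Finset.sum_eq_zero fun i hi => ?_
    rw [map_smul, P.hitL_F_mul hl, P.hitL_F_u hl (hS hi) (hJ j (by simp)),
      ih (fun k hk => hJ k (by simp [hk])) ((Finset.erase_subset _ _).trans hS) (by simp [h]),
      if_neg (by rintro rfl; exact h hi)]
    simp

lemma hitL_E_minor_of_mem (h : l ∈ S) (h' : l + 1 ∉ S) :
    P.hitL (D.E l) (P.minor J S) = P.minor J (insert (l + 1) (S.erase l)) := by
  induction J generalizing S with
  | nil =>
    rw [minor, minor, if_neg (by rintro rfl; simp at h), if_neg (by simp), map_zero]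
  | cons j J ih =>
    have hJ' : ∀ k ∈ J, k ∈ Finset.Icc 1 N := fun k hk => hJ k (by simp [hk])
    have hj := hJ j (by simp)
    have hS' : ∀ i, S.erase i ⊆ Finset.Icc 1 N := fun i => (Finset.erase_subset _ _).trans hS
    rw [minor, minor, map_sum, ← Finset.add_sum_erase S _ h, Finset.sum_insert (by simp [h'])]
    congr 1
    · rw [map_smul, P.hitL_E_mul hl, P.hitL_E_u hl (hS h) hj, if_pos rfl,
        P.hitL_E_minor_of_notMem hl hJ' (hS' l) (by simp), mul_zero, add_zero,
        Finset.erase_insert (by simp [h'])]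
      congr 2
      unfold inv
      congr 1
      ext x
      simp only [Finset.mem_filter, Finset.mem_insert, Finset.mem_erase]
      constructor
      · rintro ⟨h1, h2⟩; exact ⟨Or.inr ⟨by omega, h1⟩, by omega⟩
      · rintro ⟨rfl | ⟨h1, h2⟩, h3⟩
        · omega
        · exact ⟨h2, by omega⟩
    · refine Finset.sum_congr rfl fun i hi => ?_
      obtain ⟨h1, h2⟩ := Finset.mem_erase.1 hi
      have h3 : i ≠ l + 1 := by rintro rfl; exact h' h2
      rw [map_smul, P.hitL_E_mul hl, P.hitL_E_u hl (hS h2) hj, if_neg h1, zero_mul, zero_add,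
        P.hitL_Kg_u hl (hS h2) hj, ih hJ' (hS' i) (by simp [h, h1.symm]) (by simp [h']),
        inv_swap h h' (by omega), insert_erase_erase h3]
      simp [chi, h1, h3]

lemma hitL_F_minor_of_mem (hq : q ≠ 0) (h : l + 1 ∈ S) (h' : l ∉ S) :
    P.hitL (D.F l) (P.minor J S) = P.minor J (insert l (S.erase (l + 1))) := by
  induction J generalizing S with
  | nil =>
    rw [minor, minor, if_neg (by rintro rfl; simp at h), if_neg (by simp), map_zero]
  | cons j J ih =>
    have hJ' : ∀ k ∈ J, k ∈ Finset.Icc 1 N := fun k hk => hJ k (by simp [hk])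
    have hj := hJ j (by simp)
    have hS' : ∀ i, S.erase i ⊆ Finset.Icc 1 N := fun i => (Finset.erase_subset _ _).trans hS
    have hKi : ∀ i ∈ S, P.hitL (D.Ki l) (P.minor J (S.erase i)) =
        (∏ s ∈ S.erase i, chi q l s)⁻¹ • P.minor J (S.erase i) := fun i _ =>
      P.hitL_Ki_of_hitL_Kg hl (Finset.prod_ne_zero_iff.2 fun s _ => chi_ne hq l s)
        (P.hitL_Kg_minor hl hJ' (hS' i))
    rw [minor, minor, map_sum, ← Finset.add_sum_erase S _ h, Finset.sum_insert (by simp [h'])]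
    congr 1
    · rw [map_smul, P.hitL_F_mul hl, P.hitL_F_u hl (hS h) hj, if_pos rfl,
        P.hitL_F_minor_of_notMem hl hJ' (hS' (l + 1)) (by simp), mul_zero, add_zero,
        Finset.erase_insert (by simp [h']), hKi _ h, Finset.prod_eq_one, inv_one, one_smul]
      · congr 2
        unfold inv
        congr 1
        ext x
        simp only [Finset.mem_filter, Finset.mem_insert, Finset.mem_erase]
        constructor
        · rintro ⟨h1, h2⟩
          have : x ≠ l := by rintro rfl; exact h' h1
          exact ⟨Or.inr ⟨by omega, h1⟩, by omega⟩
        · rintro ⟨rfl | ⟨h1, h2⟩, h3⟩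
          · omega
          · exact ⟨h2, by omega⟩
      · intro s hs
        obtain ⟨h1, h2⟩ := Finset.mem_erase.1 hs
        have h3 : s ≠ l := by rintro rfl; exact h' h2
        simp [chi, h1, h3]
    · refine Finset.sum_congr rfl fun i hi => ?_
      obtain ⟨h1, h2⟩ := Finset.mem_erase.1 hi
      have h3 : i ≠ l := by rintro rfl; exact h' h2
      rw [map_smul, P.hitL_F_mul hl, P.hitL_F_u hl (hS h2) hj, if_neg h1, zero_mul, zero_add,
        ih hJ' (hS' i) (by simp [h, h1.symm]) (by simp [h']),
        inv_swap h h' (by omega), insert_erase_erase h3]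

omit hl hJ hS in
lemma inv_succ {S : Finset ℕ} {l : ℕ} (h : l ∈ S) : inv S (l + 1) = inv S l + 1 := by
  unfold inv
  have : S.filter (· < l + 1) = insert l (S.filter (· < l)) := by
    ext x
    simp only [Finset.mem_filter, Finset.mem_insert]
    constructor
    · rintro ⟨h1, h2⟩
      by_cases hx : x = l
      · exact Or.inl hx
      · exact Or.inr ⟨h1, by omega⟩
    · rintro (rfl | ⟨h1, h2⟩)
      · exact ⟨h, by omega⟩
      · exact ⟨h1, by omega⟩
  rw [this, Finset.card_insert_of_notMem (by simp)]

omit hl hJ hS in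
lemma insert_erase_erase_self {S : Finset ℕ} {a b : ℕ} (hb : b ∈ S) (hab : a ≠ b) :
    insert b ((S.erase b).erase a) = S.erase a := by
  rw [Finset.erase_right_comm, Finset.insert_erase (by simp [hb, hab.symm])]

lemma hitL_E_minor_of_mem_of_mem (hq : q ≠ 0) (h : l ∈ S) (h' : l + 1 ∈ S) :
    P.hitL (D.E l) (P.minor J S) = 0 := by
  have hq' : (q : ℂ) ≠ 0 := by exact_mod_cast hq
  induction J generalizing S with
  | nil => rw [minor, if_neg (by rintro rfl; simp at h), map_zero]
  | cons j J ih =>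
    have hJ' : ∀ k ∈ J, k ∈ Finset.Icc 1 N := fun k hk => hJ k (by simp [hk])
    have hj := hJ j (by simp)
    have hS' : ∀ i, S.erase i ⊆ Finset.Icc 1 N := fun i => (Finset.erase_subset _ _).trans hS
    have hm : l + 1 ∈ S.erase l := by simp [h']
    rw [minor, map_sum, ← Finset.add_sum_erase S _ h, ← Finset.add_sum_erase _ _ hm,
      ← add_assoc, Finset.sum_eq_zero, add_zero]
    · rw [map_smul, P.hitL_E_mul hl, P.hitL_E_u hl (hS h) hj, if_pos rfl,
        P.hitL_E_minor_of_notMem hl hJ' (hS' l) (by simp), mul_zero, add_zero, map_smul,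
        P.hitL_E_mul hl, P.hitL_E_u hl (hS h') hj, if_neg (by omega), zero_mul, zero_add,
        P.hitL_Kg_u hl (hS h') hj, P.hitL_E_minor_of_mem hl hJ' (hS' (l + 1)) (by simp [h])
          (by simp), insert_erase_erase_self h' (by omega), smul_mul_assoc, smul_smul, ← add_smul,
        inv_succ h]
      have : (-(q : ℂ)) ^ inv S l + (-(q : ℂ)) ^ (inv S l + 1) * chi q l (l + 1) = 0 := by
        simp [chi, pow_succ, hq']
      rw [this, zero_smul]
    · intro i hi
      simp only [Finset.mem_erase] at hi
      obtain ⟨h1, h2, h3⟩ := hi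
      rw [map_smul, P.hitL_E_mul hl, P.hitL_E_u hl (hS h3) hj, if_neg h2, zero_mul, zero_add,
        ih hJ' (hS' i) (by simp [h, h2.symm]) (by simp [h', h1.symm]), mul_zero, smul_zero]

lemma hitL_F_minor_of_mem_of_mem (hq : q ≠ 0) (h : l ∈ S) (h' : l + 1 ∈ S) :
    P.hitL (D.F l) (P.minor J S) = 0 := by
  have hq' : (q : ℂ) ≠ 0 := by exact_mod_cast hq
  induction J generalizing S with
  | nil => rw [minor, if_neg (by rintro rfl; simp at h), map_zero]
  | cons j J ih =>
    have hJ' : ∀ k ∈ J, k ∈ Finset.Icc 1 N := fun k hk => hJ k (by simp [hk])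
    have hj := hJ j (by simp)
    have hS' : ∀ i, S.erase i ⊆ Finset.Icc 1 N := fun i => (Finset.erase_subset _ _).trans hS
    have hm : l + 1 ∈ S.erase l := by simp [h']
    have hm' : l ∈ S.erase (l + 1) := by simp [h]
    rw [minor, map_sum, ← Finset.add_sum_erase S _ h, ← Finset.add_sum_erase _ _ hm,
      ← add_assoc, Finset.sum_eq_zero, add_zero]
    · have hK := P.hitL_Ki_of_hitL_Kg hl
        (Finset.prod_ne_zero_iff.2 fun s _ => chi_ne hq l s) (P.hitL_Kg_minor hl hJ' (hS' (l + 1)))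
      have hp : ∏ s ∈ S.erase (l + 1), chi q l s = q := by
        rw [← Finset.mul_prod_erase _ _ hm', Finset.prod_eq_one, mul_one]
        · simp [chi]
        · intro s hs
          simp only [Finset.mem_erase] at hs
          simp [chi, hs.1, hs.2.1]
      rw [map_smul, P.hitL_F_mul hl, P.hitL_F_u hl (hS h) hj, if_neg (by omega), zero_mul, zero_add,
        map_smul, P.hitL_F_mul hl, P.hitL_F_u hl (hS h') hj, if_pos rfl,
        P.hitL_F_minor_of_notMem hl hJ' (hS' (l + 1)) (by simp), mul_zero, add_zero,
        hK, P.hitL_F_minor_of_mem hl hJ' (hS' l) hq (by simp [h']) (by simp),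
        insert_erase_erase_self h (by omega), mul_smul_comm, smul_smul, ← add_smul,
        inv_succ h, hp]
      have : (-(q : ℂ)) ^ inv S l + (-(q : ℂ)) ^ (inv S l + 1) * (q : ℂ)⁻¹ = 0 := by
        simp [pow_succ, hq']
      rw [this, zero_smul]
    · intro i hi
      simp only [Finset.mem_erase] at hi
      obtain ⟨h1, h2, h3⟩ := hi
      rw [map_smul, P.hitL_F_mul hl, P.hitL_F_u hl (hS h3) hj, if_neg h1, zero_mul, zero_add,
        ih hJ' (hS' i) (by simp [h, h2.symm]) (by simp [h', h1.symm]), mul_zero, smul_zero]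

omit hl hJ hS in
lemma pair_one_minor (a k : ℕ) (ha : 1 ≤ a) (hk : a + k ≤ N + 1) :
    P.pair 1 (P.minor (List.range' a k) (Finset.Ico a (a + k))) = 1 := by
  induction k generalizing a with
  | zero => simp [minor, P.pair_oneA]
  | succ k ih =>
    have hmem : ∀ i ∈ Finset.Ico a (a + (k + 1)), i ∈ Finset.Icc 1 N := fun i hi => by
      simp only [Finset.mem_Ico, Finset.mem_Icc] at *; omega
    have ha' : a ∈ Finset.Ico a (a + (k + 1)) := by simp
    rw [List.range'_succ, minor, map_sum, Finset.sum_eq_single_of_mem a ha']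
    · have h1 : inv (Finset.Ico a (a + (k + 1))) a = 0 := by
        unfold inv
        rw [Finset.card_eq_zero, Finset.filter_eq_empty_iff]
        intro x hx
        simp only [Finset.mem_Ico] at hx
        omega
      have h2 : (Finset.Ico a (a + (k + 1))).erase a = Finset.Ico (a + 1) (a + 1 + k) := by
        ext x
        simp only [Finset.mem_erase, Finset.mem_Ico]
        omega
      rw [h1, h2, pow_zero, one_smul, pair_one_mul, ih (a + 1) (by omega) (by omega), P.pair_oneU,
        P.counit_u a (hmem a ha') a (hmem a ha')]
      simp
    · intro i hi hia
      rw [map_smul, pair_one_mul, P.pair_oneU, P.counit_u i (hmem i hi) a (hmem a ha')]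
      simp [hia]

end QslnFun

/-- Coordinates of the simple roots of `sl_N`. -/
def rootCoord (i k : ℕ) : ℤ := (if k = i then 1 else 0) - (if k = i + 1 then 1 else 0)

lemma sum_mul_rootCoord (n i : ℕ) (hi : i + 1 < n) (f : ℕ → ℤ) :
    ∑ k ∈ Finset.range n, f k * rootCoord i k = f i - f (i + 1) := by
  unfold rootCoord
  simp only [mul_sub, mul_ite, mul_one, mul_zero, Finset.sum_sub_distrib, Finset.sum_ite_eq',
    Finset.mem_range]
  rw [if_pos (by omega), if_pos hi]

lemma cartanSL_eq (n i j : ℕ) (hi : i + 1 < n) (hj : j + 1 < n) :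
    cartanSL i j = ∑ k ∈ Finset.range n, rootCoord j k * rootCoord i k := by
  rw [sum_mul_rootCoord n i hi]
  unfold cartanSL rootCoord
  split_ifs <;> omega

lemma cartanSL_symm (i j : ℕ) : cartanSL i j = cartanSL j i := by
  rw [cartanSL_eq (i + j + 2) i j (by omega) (by omega),
    cartanSL_eq (i + j + 2) j i (by omega) (by omega)]
  exact Finset.sum_congr rfl fun k _ => mul_comm _ _

/-- Nodes of the Dynkin diagram of `sl_N`. -/
abbrev Node (N : ℕ) := {i : ℕ // i ∈ Finset.Icc 1 (N - 1)}

lemma cartanSL_pos {N : ℕ} (β : Multiset (Node N)) (hβ : β ≠ 0) :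
    (β.map fun i => (β.map fun j => cartanSL i.1 j.1).sum).sum ≠ 0 := by
  have hlt : ∀ i : Node N, i.1 + 1 < N + 1 := fun i => by
    have := Finset.mem_Icc.1 i.2; omega
  set v : ℕ → ℤ := fun k => (β.map fun i => rootCoord i.1 k).sum with hv
  have h1 : (β.map fun i => (β.map fun j => cartanSL i.1 j.1).sum).sum =
      ∑ k ∈ Finset.range (N + 1), v k * v k := by
    have : ∀ i j : Node N, cartanSL i.1 j.1 =
        ∑ k ∈ Finset.range (N + 1), rootCoord j.1 k * rootCoord i.1 k := fun i j =>
      cartanSL_eq _ _ _ (hlt i) (hlt j)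
    simp only [this, Multiset.sum_map_sum, Multiset.sum_map_mul_right]
    simp only [Multiset.sum_map_mul_left, hv]
  rw [h1]
  intro h0
  have h2 := (Finset.sum_eq_zero_iff_of_nonneg fun k _ => mul_self_nonneg (v k)).1 h0
  have h3 : ∑ k ∈ Finset.range (N + 1), (-(k : ℤ)) * v k = 0 :=
    Finset.sum_eq_zero fun k hk => by rw [mul_self_eq_zero.1 (h2 k hk), mul_zero]
  have h4 : ∑ k ∈ Finset.range (N + 1), (-(k : ℤ)) * v k = (β.map fun _ => (1 : ℤ)).sum := by
    simp only [hv, ← Multiset.sum_map_mul_left, ← Multiset.sum_map_sum]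
    congr 1
    refine Multiset.map_congr rfl fun i _ => ?_
    rw [sum_mul_rootCoord _ _ (hlt i)]
    push_cast
    ring
  rw [h4] at h3
  simp at h3
  exact hβ h3

namespace QslnFun

variable {q : ℝ} {N : ℕ} {D : UqslData q N} (P : QslnFun q N D)

/-- Matrix coefficients of a representation of `U` compatible with the star structure. -/
structure IsStarSystem {n : Type} [Fintype n] [DecidableEq n] (a : n → n → P.A) : Prop where
  comul : ∀ i j, Coalgebra.comul (R := ℂ) (a i j) = ∑ k, a i k ⊗ₜ[ℂ] a k j
  counit : ∀ i j, Coalgebra.counit (R := ℂ) (a i j) = if i = j then 1 else 0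
  star_E : ∀ l ∈ Finset.Icc 1 (N - 1), ∀ i j,
    star (P.pair (D.E l) (a i j)) = q * P.pair (D.Kg l * D.F l) (a j i)
  star_K : ∀ l ∈ Finset.Icc 1 (N - 1), ∀ i j,
    star (P.pair (D.Kg l) (a i j)) = P.pair (D.Kg l) (a j i)

lemma IsStarSystem.one : P.IsStarSystem (fun (_ _ : Unit) => (1 : P.A)) where
  comul i j := by simp [Bialgebra.comul_one, Algebra.TensorProduct.one_def]
  counit i j := by simp
  star_E l hl i j := by
    simp [P.pair_oneA, D.counit_E l hl, D.counit_F l hl]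
  star_K l hl i j := by simp [P.pair_oneA, D.counit_Kg l hl]

lemma IsStarSystem.mul {n m : Type} [Fintype n] [DecidableEq n] [Fintype m] [DecidableEq m]
    {a : n → n → P.A} {b : m → m → P.A} (ha : P.IsStarSystem a) (hb : P.IsStarSystem b) :
    P.IsStarSystem (fun (i j : n × m) => a i.1 j.1 * b i.2 j.2) where
  comul i j := by
    rw [Bialgebra.comul_mul, ha.comul, hb.comul, Finset.sum_mul_sum, Fintype.sum_prod_type]
    simp
  counit i j := by
    rw [Bialgebra.counit_mul, ha.counit, hb.counit]
    by_cases h1 : i.1 = j.1 <;> by_cases h2 : i.2 = j.2 <;> simp [h1, h2, Prod.ext_iff]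
  star_E l hl i j := by
    have e1 : P.pair (D.E l) (a i.1 j.1 * b i.2 j.2) = P.pair (D.E l) (a i.1 j.1) *
        (if i.2 = j.2 then 1 else 0) + P.pair (D.Kg l) (a i.1 j.1) * P.pair (D.E l) (b i.2 j.2) := by
      rw [pair_mul_eq, D.comul_E l hl, map_add]
      simp [pair₂, P.pair_oneU, hb.counit]
    have e2 : P.pair (D.Kg l * D.F l) (a j.1 i.1 * b j.2 i.2) =
        P.pair (D.Kg l * D.F l) (a j.1 i.1) * (if j.2 = i.2 then 1 else 0) +
          P.pair (D.Kg l) (a j.1 i.1) * P.pair (D.Kg l * D.F l) (b j.2 i.2) := by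
      rw [pair_mul_eq, Bialgebra.comul_mul, D.comul_Kg l hl, D.comul_F l hl, mul_add,
        Algebra.TensorProduct.tmul_mul_tmul, Algebra.TensorProduct.tmul_mul_tmul,
        (D.rels.1 l hl).1, map_add]
      simp [pair₂, P.pair_oneU, hb.counit]
    rw [e1, e2, star_add, star_mul', star_mul', ha.star_E l hl, ha.star_K l hl, hb.star_E l hl]
    by_cases h2 : i.2 = j.2
    · rw [if_pos h2, if_pos h2.symm, star_one]
      ring
    · rw [if_neg h2, if_neg (Ne.symm h2), star_zero]
      ring
  star_K l hl i j := by
    have e : ∀ x y, P.pair (D.Kg l) (x * y) = P.pair (D.Kg l) x * P.pair (D.Kg l) y := by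
      intro x y
      rw [pair_mul_eq, D.comul_Kg l hl]
      simp [pair₂]
    rw [e, e, star_mul', ha.star_K l hl, hb.star_K l hl]

lemma IsStarSystem.vec (hq : q ≠ 0) :
    P.IsStarSystem (fun (i j : Finset.Icc 1 N) => P.u i.1 j.1) where
  comul i j := by
    rw [P.comul_u _ i.2 _ j.2]
    exact (Finset.sum_coe_sort (Finset.Icc 1 N) fun k => P.u i.1 k ⊗ₜ[ℂ] P.u k j.1).symm
  counit i j := by
    rw [P.counit_u _ i.2 _ j.2]
    exact if_congr Subtype.ext_iff.symm rfl rfl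
  star_E l hl i j := by
    have hq' : (q : ℂ) ≠ 0 := by exact_mod_cast hq
    rw [← pair_hitL, P.hitL_Kg_u hl j.2 i.2, map_smul, P.pair_E l hl _ i.2 _ j.2,
      P.pair_F l hl _ j.2 _ i.2]
    by_cases h1 : (i : ℕ) = l <;> by_cases h2 : (j : ℕ) = l + 1 <;> simp [h1, h2, chi, hq']
  star_K l hl i j := by
    rw [P.pair_Kg l hl _ i.2 _ j.2, P.pair_Kg l hl _ j.2 _ i.2]
    by_cases h : (i : ℕ) = j
    · rw [h]; split_ifs <;> simp
    · simp [h, Ne.symm h]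

/-- The representation of `U` attached to a system of matrix coefficients. -/
def IsStarSystem.rep {n : Type} [Fintype n] [DecidableEq n] {a : n → n → P.A}
    (ha : P.IsStarSystem a) : D.U →ₐ[ℂ] Matrix n n ℂ :=
  AlgHom.ofLinearMap
    { toFun := fun x => Matrix.of fun i j => P.pair x (a i j)
      map_add' := fun x y => by ext; simp
      map_smul' := fun z x => by ext; simp }
    (by ext i j; simp [P.pair_oneU, ha.counit, Matrix.one_apply])
    (fun x y => by ext i j; simp [P.pair_mulU, ha.comul, Matrix.mul_apply])

lemma IsStarSystem.rep_apply {n : Type} [Fintype n] [DecidableEq n] {a : n → n → P.A}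
    (ha : P.IsStarSystem a) (x : D.U) (i j : n) :
    IsStarSystem.rep P ha x i j = P.pair x (a i j) := rfl

include P in
lemma eq_zero_of_rep (hq : q ≠ 0) (x : D.U)
    (h : ∀ (n : Type) [Fintype n] [DecidableEq n] (ρ : D.U →ₐ[ℂ] Matrix n n ℂ),
      (∀ l ∈ Finset.Icc 1 (N - 1),
        (ρ (D.E l)).conjTranspose = (q : ℂ) • (ρ (D.Kg l) * ρ (D.F l))) →
      (∀ l ∈ Finset.Icc 1 (N - 1), (ρ (D.Kg l)).conjTranspose = ρ (D.Kg l)) → ρ x = 0) :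
    x = 0 := by
  have key : ∀ a ∈ Submonoid.closure
      {x : P.A | ∃ i ∈ Finset.Icc 1 N, ∃ j ∈ Finset.Icc 1 N, x = P.u i j},
      ∃ (n : Type) (_ : Fintype n) (_ : DecidableEq n) (s : n → n → P.A),
        P.IsStarSystem s ∧ ∃ i j, a = s i j := by
    intro a ha
    induction ha using Submonoid.closure_induction with
    | mem a ha =>
      obtain ⟨i, hi, j, hj, rfl⟩ := ha
      exact ⟨_, _, _, _, IsStarSystem.vec P hq, ⟨i, hi⟩, ⟨j, hj⟩, rfl⟩
    | one => exact ⟨_, _, _, _, IsStarSystem.one P, (), (), rfl⟩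
    | mul a b _ _ ha hb =>
      obtain ⟨n, _, _, s, hs, i, j, rfl⟩ := ha
      obtain ⟨m, _, _, t, ht, k, l, rfl⟩ := hb
      exact ⟨_, _, _, _, IsStarSystem.mul P hs ht, (i, k), (j, l), rfl⟩
  refine P.nondegU x fun a => ?_
  have ha : a ∈ Submodule.span ℂ (Submonoid.closure
      {x : P.A | ∃ i ∈ Finset.Icc 1 N, ∃ j ∈ Finset.Icc 1 N, x = P.u i j} : Set P.A) := by
    rw [← Algebra.adjoin_eq_span, P.genA]; trivial
  induction ha using Submodule.span_induction with
  | mem a ha =>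
    obtain ⟨n, _, _, s, hs, i, j, rfl⟩ := key a ha
    rw [← IsStarSystem.rep_apply P hs, h n (IsStarSystem.rep P hs)]
    · rfl
    · intro l hl
      rw [← map_mul]
      ext i j
      simp only [Matrix.conjTranspose_apply, Matrix.smul_apply, IsStarSystem.rep_apply, smul_eq_mul]
      exact hs.star_E l hl j i
    · intro l hl
      ext i j
      simp only [Matrix.conjTranspose_apply, IsStarSystem.rep_apply]
      exact hs.star_K l hl j i
  | zero => simp
  | add a b _ _ ha hb => rw [map_add, ha, hb, add_zero]
  | smul z a _ ha => rw [map_smul, ha, smul_zero]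

end QslnFun

lemma zpow_ne_one_of_transcendental {q : ℝ} (hq : Transcendental ℚ q) {k : ℤ} (hk : k ≠ 0) :
    (q : ℂ) ^ k ≠ 1 := by
  have key : ∀ n : ℕ, n ≠ 0 → q ^ n ≠ 1 := fun n hn h =>
    (hq.pow (Nat.pos_of_ne_zero hn)) (h ▸ isAlgebraic_one)
  intro h
  have h' : (q : ℝ) ^ k = 1 := by exact_mod_cast h
  obtain ⟨n, rfl | rfl⟩ := k.eq_nat_or_neg
  · exact key n (by simpa using hk) (by simpa using h')
  · exact key n (by simpa using hk) (by simpa using h')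

lemma ne_zero_of_transcendental {q : ℝ} (hq : Transcendental ℚ q) : q ≠ 0 := by
  rintro rfl
  exact hq isAlgebraic_zero

lemma ne_inv_of_transcendental {q : ℝ} (hq : Transcendental ℚ q) : (q : ℂ) ≠ (q : ℂ)⁻¹ := by
  intro h
  have h0 : (q : ℂ) ≠ 0 := by exact_mod_cast ne_zero_of_transcendental hq
  refine zpow_ne_one_of_transcendental hq (k := 2) two_ne_zero ?_
  rw [zpow_two]
  nth_rewrite 2 [h]
  exact mul_inv_cancel₀ h0

lemma List.prod_map_range'_eq_prod_Ico {M : Type*} [CommMonoid M] (f : ℕ → M) (a k : ℕ) :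
    ((List.range' a k).map f).prod = ∏ i ∈ Finset.Ico a (a + k), f i := by
  induction k generalizing a with
  | zero => simp
  | succ k ih =>
    rw [List.range'_succ, List.map_cons, List.prod_cons, ih, add_right_comm, add_assoc,
      ← Finset.prod_eq_prod_Ico_succ_bot (by omega)]

namespace QslnFun

lemma prod_chi (q : ℝ) (l : ℕ) (S : Finset ℕ) : ∏ s ∈ S, chi q l s =
    (if l ∈ S then (q : ℂ) else 1) * (if l + 1 ∈ S then (q : ℂ)⁻¹ else 1) := by
  have : ∀ s, chi q l s =
      (if s = l then (q : ℂ) else 1) * (if s = l + 1 then (q : ℂ)⁻¹ else 1) := by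
    intro s
    unfold chi
    split_ifs <;> first | omega | simp
  simp only [this, Finset.prod_mul_distrib, Finset.prod_ite_eq']

variable {q : ℝ} {N r : ℕ} {D : UqslData q N} (P : QslnFun q N D)

lemma mem_Icc_of_node (i : Node N) : i.1 ∈ Finset.Icc 1 N := by
  have := Finset.mem_Icc.1 i.2
  exact Finset.mem_Icc.2 (by omega)

lemma pair_Kg_mul_u (i j : Node N) (v : D.U) :
    P.pair (D.Kg j.1 * v) (P.u i.1 i.1) = chi q j.1 i.1 * P.pair v (P.u i.1 i.1) := by
  rw [← pair_hitL, hitL_Kg_u P j.2 (mem_Icc_of_node i) (mem_Icc_of_node i), map_smul, smul_eq_mul]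

lemma pair_mul_Kg_u (i j : Node N) (v : D.U) :
    P.pair (v * D.Kg j.1) (P.u i.1 i.1) = chi q j.1 i.1 * P.pair v (P.u i.1 i.1) := by
  rw [← pair_hitR, hitR_Kg_u P j.2 (mem_Icc_of_node i) (mem_Icc_of_node i), map_smul, smul_eq_mul]

lemma pair_Ki_mul_u (i j : Node N) (v : D.U) :
    P.pair (D.Ki j.1 * v) (P.u i.1 i.1) = (chi q j.1 i.1)⁻¹ * P.pair v (P.u i.1 i.1) := by
  rw [← pair_hitL, hitL_Ki_u P j.2 (mem_Icc_of_node i) (mem_Icc_of_node i), map_smul, smul_eq_mul]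

lemma pair_mul_Ki_u (i j : Node N) (v : D.U) :
    P.pair (v * D.Ki j.1) (P.u i.1 i.1) = (chi q j.1 i.1)⁻¹ * P.pair v (P.u i.1 i.1) := by
  rw [← pair_hitR, hitR_Ki_u P j.2 (mem_Icc_of_node i) (mem_Icc_of_node i), map_smul, smul_eq_mul]

section Minors

variable {a k : ℕ}

lemma mem_Icc_of_mem_range' (ha : 1 ≤ a) (hk : a + k ≤ N + 1) :
    ∀ j ∈ List.range' a k, j ∈ Finset.Icc 1 N := fun j hj => by
  rw [List.mem_range'_1] at hj
  exact Finset.mem_Icc.2 (by omega)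

lemma Ico_subset_Icc_one (ha : 1 ≤ a) (hk : a + k ≤ N + 1) :
    Finset.Ico a (a + k) ⊆ Finset.Icc 1 N := fun j hj => by
  rw [Finset.mem_Ico] at hj
  exact Finset.mem_Icc.2 (by omega)

/-- The principal quantum minor on the indices `a, …, a + k - 1`. -/
def prin (a k : ℕ) : P.A := P.minor (List.range' a k) (Finset.Ico a (a + k))

variable {l : ℕ} (hl : l ∈ Finset.Icc 1 (N - 1)) (ha : 1 ≤ a) (hk : a + k ≤ N + 1)
include hl ha hk

lemma hitL_Kg_prin {χ : ℂ} (hχ : ∏ s ∈ Finset.Ico a (a + k), chi q l s = χ) :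
    P.hitL (D.Kg l) (P.prin a k) = χ • P.prin a k := by
  rw [prin, P.hitL_Kg_minor hl (mem_Icc_of_mem_range' ha hk) (Ico_subset_Icc_one ha hk), hχ]

lemma pair_mul_Kg_prin {χ : ℂ} (hχ : ∏ s ∈ Finset.Ico a (a + k), chi q l s = χ) (v : D.U) :
    P.pair (v * D.Kg l) (P.prin a k) = χ * P.pair v (P.prin a k) := by
  rw [← pair_hitR, prin, P.hitR_Kg_minor hl (mem_Icc_of_mem_range' ha hk)
    (Ico_subset_Icc_one ha hk), List.prod_map_range'_eq_prod_Ico, hχ, map_smul, smul_eq_mul]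

lemma pair_mul_Ki_prin {χ : ℂ} (h0 : χ ≠ 0)
    (hχ : ∏ s ∈ Finset.Ico a (a + k), chi q l s = χ) (v : D.U) :
    P.pair (v * D.Ki l) (P.prin a k) = χ⁻¹ * P.pair v (P.prin a k) := by
  have := P.pair_mul_Kg_prin hl ha hk hχ (v * D.Ki l)
  rw [mul_assoc, (D.rels.1 l hl).2, mul_one] at this
  rw [this, inv_mul_cancel_left₀ h0]

lemma hitL_E_prin (hq : q ≠ 0) (h : l + 1 ≠ a + k) : P.hitL (D.E l) (P.prin a k) = 0 := by
  have hJ := mem_Icc_of_mem_range' ha hk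
  have hS := Ico_subset_Icc_one ha hk
  by_cases h1 : l ∈ Finset.Ico a (a + k)
  · refine P.hitL_E_minor_of_mem_of_mem hl hJ hS hq h1 ?_
    rw [Finset.mem_Ico] at h1 ⊢
    omega
  · exact P.hitL_E_minor_of_notMem hl hJ hS h1

lemma hitL_F_prin (hq : q ≠ 0) (h : l + 1 ≠ a) : P.hitL (D.F l) (P.prin a k) = 0 := by
  have hJ := mem_Icc_of_mem_range' ha hk
  have hS := Ico_subset_Icc_one ha hk
  by_cases h1 : l + 1 ∈ Finset.Ico a (a + k)
  · refine P.hitL_F_minor_of_mem_of_mem hl hJ hS hq ?_ h1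
    rw [Finset.mem_Ico] at h1 ⊢
    omega
  · exact P.hitL_F_minor_of_notMem hl hJ hS h1

end Minors

lemma prod_chi_low (hq : q ≠ 0) {l : ℕ} (hl : l ∈ Finset.Icc 1 (N - 1)) :
    ∏ s ∈ Finset.Ico 1 (1 + r), chi q l s = if l = r then (q : ℂ) else 1 := by
  have hq' : (q : ℂ) ≠ 0 := by exact_mod_cast hq
  have hl' := (Finset.mem_Icc.1 hl).1
  rw [prod_chi]
  simp only [Finset.mem_Ico]
  rcases lt_trichotomy l r with h | h | h
  · rw [if_pos (by omega), if_pos (by omega), if_neg h.ne, mul_inv_cancel₀ hq']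
  · rw [if_pos (by omega), if_neg (by omega), if_pos h, mul_one]
  · rw [if_neg (by omega), if_neg (by omega), if_neg h.ne', mul_one]

lemma prod_chi_high (hq : q ≠ 0) {l : ℕ} (hl : l ∈ Finset.Icc 1 (N - 1)) :
    ∏ s ∈ Finset.Ico (r + 1) (r + 1 + (N - r)), chi q l s =
      if l = r then (q : ℂ)⁻¹ else 1 := by
  have hq' : (q : ℂ) ≠ 0 := by exact_mod_cast hq
  have hl' := Finset.mem_Icc.1 hl
  rw [prod_chi]
  simp only [Finset.mem_Ico]
  rcases lt_trichotomy l r with h | h | h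
  · rw [if_neg (by omega), if_neg (by omega), if_neg h.ne, mul_one]
  · rw [if_neg (by omega), if_pos (by omega), if_pos h, one_mul]
  · rw [if_pos (by omega), if_pos (by omega), if_neg h.ne', mul_inv_cancel₀ hq']

/-- The positive half of `U` paired with `A`. -/
def halfPos (hq : Transcendental ℚ q) (r : Node N) : QuantumHalf (Node N) D.U P.A :=
  have h0 : q ≠ 0 := ne_zero_of_transcendental hq
  have hq0 : (q : ℂ) ≠ 0 := by exact_mod_cast h0
  have hr := Finset.mem_Icc.1 r.2
  have hk : 1 + r.1 ≤ N + 1 := by omega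
  { q := q
    κ := ((q : ℂ) - (q : ℂ)⁻¹)⁻¹
    c := fun i j => cartanSL i.1 j.1
    r := r
    E := fun i => D.E i.1
    F := fun i => D.F i.1
    K := fun i => D.Kg i.1
    Ki := fun i => D.Ki i.1
    pair := P.pair
    hL := fun u => P.hitL u
    hR := fun u => P.hitR u
    g := fun i => P.u i.1 i.1
    m := P.prin 1 r.1
    q_ne := hq0
    q_pow := fun k hk => zpow_ne_one_of_transcendental hq hk
    κ_ne := inv_ne_zero (sub_ne_zero.2 (ne_inv_of_transcendental hq))
    c_symm := fun i j => cartanSL_symm i.1 j.1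
    c_pos := cartanSL_pos
    K_Ki := fun i => (D.rels.1 i.1 i.2).1
    Ki_K := fun i => (D.rels.1 i.1 i.2).2
    K_K := fun i j => D.rels.2.1 i.1 i.2 j.1 j.2
    K_E := fun i j => D.rels.2.2.1 i.1 i.2 j.1 j.2
    E_F := fun i j => by
      rw [D.rels.2.2.2.2.1 i.1 i.2 j.1 j.2]
      exact if_congr Subtype.ext_iff.symm rfl rfl
    rep := fun x h => P.eq_zero_of_rep h0 x fun n _ _ ρ h1 _ => h n ρ fun i => h1 i.1 i.2
    pair_hL := fun u v a => P.pair_hitL u v a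
    pair_hR := fun u v a => P.pair_hitR u v a
    nondegU := P.nondegU
    nondegA := P.nondegA
    hL_E_mul := fun i => P.hitL_E_mul i.2
    hL_F_mul := fun i => P.hitL_F_mul i.2
    hL_K_mul := fun i => P.hitL_Kg_mul i.2
    hL_Ki_mul := fun i => P.hitL_Ki_mul i.2
    pair_one := P.pair_one_mul
    g_wt := fun i j => ⟨chi q j.1 i.1, chi_ne h0 _ _, P.pair_Kg_mul_u i j, P.pair_mul_Kg_u i j⟩
    g_ne := fun i => by
      rw [P.pair_Kg i.1 i.2 _ (mem_Icc_of_node i) _ (mem_Icc_of_node i),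
        P.pair_Ki i.1 i.2 _ (mem_Icc_of_node i) _ (mem_Icc_of_node i)]
      simpa using ne_inv_of_transcendental hq
    m_F := fun i => P.hitL_F_prin i.2 le_rfl hk h0 (by have := Finset.mem_Icc.1 i.2; omega)
    m_E := fun i hi => P.hitL_E_prin i.2 le_rfl hk h0
      (fun h => hi (Subtype.ext (by omega)))
    m_KL := fun i v => by
      rw [← pair_hitL, P.hitL_Kg_prin i.2 le_rfl hk (prod_chi_low h0 i.2), map_smul, smul_eq_mul]
      simp only [Subtype.ext_iff]
    m_KR := fun i v => by
      rw [P.pair_mul_Kg_prin i.2 le_rfl hk (prod_chi_low h0 i.2)]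
      simp only [Subtype.ext_iff]
    m_one := P.pair_one_minor 1 r.1 le_rfl hk }

lemma Ki_mul_F (hq : q ≠ 0) (i j : Node N) :
    D.Ki i.1 * D.F j.1 = (q : ℂ) ^ cartanSL i.1 j.1 • (D.F j.1 * D.Ki i.1) := by
  have hq0 : (q : ℂ) ≠ 0 := by exact_mod_cast hq
  have h := D.rels.2.2.2.1 i.1 i.2 j.1 j.2
  have h1 := (D.rels.1 i.1 i.2).1
  have h2 := (D.rels.1 i.1 i.2).2
  have h3 : D.F j.1 * D.Kg i.1 = (q : ℂ) ^ cartanSL i.1 j.1 • (D.Kg i.1 * D.F j.1) := by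
    rw [h, smul_smul, ← zpow_add₀ hq0, add_neg_cancel, zpow_zero, one_smul]
  calc D.Ki i.1 * D.F j.1 = D.Ki i.1 * (D.F j.1 * D.Kg i.1) * D.Ki i.1 := by
        rw [mul_assoc, mul_assoc, h1, mul_one]
    _ = _ := by
        rw [h3, mul_smul_comm, smul_mul_assoc, ← mul_assoc, h2, one_mul]

lemma Ki_mul_Ki (i j : Node N) : D.Ki i.1 * D.Ki j.1 = D.Ki j.1 * D.Ki i.1 := by
  have h1 := D.rels.1 i.1 i.2
  have h2 := D.rels.1 j.1 j.2
  exact Commute.units_inv_left (u := ⟨D.Kg i.1, D.Ki i.1, h1.1, h1.2⟩)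
    (Commute.units_inv_right (u := ⟨D.Kg j.1, D.Ki j.1, h2.1, h2.2⟩)
      (D.rels.2.1 i.1 i.2 j.1 j.2))

lemma E_mul_Ki (i : Node N) :
    D.E i.1 * D.Ki i.1 = ((q : ℂ) * q) • (D.Ki i.1 * D.E i.1) := by
  have h := D.rels.2.2.1 i.1 i.2 i.1 i.2
  have h1 := (D.rels.1 i.1 i.2).1
  have h2 := (D.rels.1 i.1 i.2).2
  have hc : (q : ℂ) ^ cartanSL i.1 i.1 = q * q := by
    rw [← zpow_two]
    simp [cartanSL]
  rw [hc] at h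
  calc D.E i.1 * D.Ki i.1 = D.Ki i.1 * (D.Kg i.1 * D.E i.1) * D.Ki i.1 := by
        rw [← mul_assoc, h2, one_mul]
    _ = _ := by
        rw [h, mul_smul_comm, smul_mul_assoc, mul_assoc, mul_assoc, h1, mul_one]

open MulOpposite in
/-- The negative half of `U` paired with the opposite algebra of `A`. -/
def halfNeg (hq : Transcendental ℚ q) (r : Node N) : QuantumHalf (Node N) D.U P.Aᵐᵒᵖ :=
  have h0 : q ≠ 0 := ne_zero_of_transcendental hq
  have hq0 : (q : ℂ) ≠ 0 := by exact_mod_cast h0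
  have hr := Finset.mem_Icc.1 r.2
  have ha : 1 ≤ r.1 + 1 := by omega
  have hk : r.1 + 1 + (N - r.1) ≤ N + 1 := by omega
  have hinv : ∀ i : Node N, (if i.1 = r.1 then (q : ℂ)⁻¹ else 1) ≠ 0 := fun i => by
    split_ifs <;> simp [hq0]
  have hinv' : ∀ i : Node N, (if i.1 = r.1 then (q : ℂ)⁻¹ else 1)⁻¹ =
      if i = r then (q : ℂ) else 1 := fun i => by
    simp only [Subtype.ext_iff]
    split_ifs <;> simp
  { q := q
    κ := ((q : ℂ) - (q : ℂ)⁻¹)⁻¹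
    c := fun i j => cartanSL i.1 j.1
    r := r
    E := fun i => D.F i.1
    F := fun i => D.E i.1
    K := fun i => D.Ki i.1
    Ki := fun i => D.Kg i.1
    pair := P.pair.compl₂ (opLinearEquiv ℂ).symm.toLinearMap
    hL := fun u a => op (P.hitL u (unop a))
    hR := fun u a => op (P.hitR u (unop a))
    g := fun i => op (P.u i.1 i.1)
    m := op (P.prin (r.1 + 1) (N - r.1))
    q_ne := hq0
    q_pow := fun k hk => zpow_ne_one_of_transcendental hq hk
    κ_ne := inv_ne_zero (sub_ne_zero.2 (ne_inv_of_transcendental hq))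
    c_symm := fun i j => cartanSL_symm i.1 j.1
    c_pos := cartanSL_pos
    K_Ki := fun i => (D.rels.1 i.1 i.2).2
    Ki_K := fun i => (D.rels.1 i.1 i.2).1
    K_K := Ki_mul_Ki
    K_E := Ki_mul_F h0
    E_F := fun i j => by
      have h := D.rels.2.2.2.2.1 j.1 j.2 i.1 i.2
      rw [← neg_sub, h]
      simp only [Subtype.ext_iff, eq_comm (a := j.1)]
      split_ifs with hij
      · rw [hij, ← smul_neg, neg_sub]
      · exact neg_zero
    rep := fun x h => P.eq_zero_of_rep h0 x fun n _ _ ρ h1 h2 => h n ρ fun i => by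
      have e1 := congrArg Matrix.conjTranspose (h1 i.1 i.2)
      rw [Matrix.conjTranspose_conjTranspose, Matrix.conjTranspose_smul,
        Matrix.conjTranspose_mul, h2 i.1 i.2] at e1
      have e2 : ρ (D.E i.1) * ρ (D.Ki i.1) =
          (q : ℂ) • (ρ (D.F i.1)).conjTranspose := by
        rw [e1, smul_mul_assoc, mul_assoc, ← map_mul, (D.rels.1 i.1 i.2).1, map_one, mul_one]
        simp
      rw [← map_mul, E_mul_Ki, map_smul, map_mul, mul_smul] at e2
      exact (smul_right_injective _ hq0 e2).symm
    pair_hL := fun u v a => P.pair_hitL u v (unop a)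
    pair_hR := fun u v a => P.pair_hitR u v (unop a)
    nondegU := fun x h => P.nondegU x fun a => h (op a)
    nondegA := fun a h => unop_injective (P.nondegA (unop a) h)
    hL_E_mul := fun i a b => unop_injective <| by
      simpa [add_comm] using P.hitL_F_mul i.2 (unop b) (unop a)
    hL_F_mul := fun i a b => unop_injective <| by
      simpa [add_comm] using P.hitL_E_mul i.2 (unop b) (unop a)
    hL_K_mul := fun i a b => unop_injective <| by
      simpa using P.hitL_Ki_mul i.2 (unop b) (unop a)
    hL_Ki_mul := fun i a b => unop_injective <| by
      simpa using P.hitL_Kg_mul i.2 (unop b) (unop a)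
    pair_one := fun a b => (P.pair_one_mul (unop b) (unop a)).trans (mul_comm _ _)
    g_wt := fun i j => ⟨(chi q j.1 i.1)⁻¹, inv_ne_zero (chi_ne h0 _ _), P.pair_Ki_mul_u i j,
      P.pair_mul_Ki_u i j⟩
    g_ne := fun i => by
      change P.pair (D.Ki i.1) (P.u i.1 i.1) ≠ P.pair (D.Kg i.1) (P.u i.1 i.1)
      rw [P.pair_Kg i.1 i.2 _ (mem_Icc_of_node i) _ (mem_Icc_of_node i),
        P.pair_Ki i.1 i.2 _ (mem_Icc_of_node i) _ (mem_Icc_of_node i)]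
      simpa using (ne_inv_of_transcendental hq).symm
    m_F := fun i => unop_injective <| P.hitL_E_prin i.2 ha hk h0
      (by have := Finset.mem_Icc.1 i.2; omega)
    m_E := fun i hi => unop_injective <| P.hitL_F_prin i.2 ha hk h0
      (fun h => hi (Subtype.ext (by omega)))
    m_KL := fun i v => by
      change P.pair (D.Ki i.1 * v) (P.prin _ _) = _ * P.pair v (P.prin _ _)
      rw [← pair_hitL, hitL_Ki_of_hitL_Kg P i.2 (hinv i)
        (P.hitL_Kg_prin i.2 ha hk (prod_chi_high h0 i.2)), map_smul, smul_eq_mul, hinv']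
    m_KR := fun i v => by
      change P.pair (v * D.Ki i.1) (P.prin _ _) = _ * P.pair v (P.prin _ _)
      rw [P.pair_mul_Ki_prin i.2 ha hk (hinv i) (prod_chi_high h0 i.2), hinv']
    m_one := P.pair_one_minor (r.1 + 1) (N - r.1) ha hk }

end QslnFun

namespace QuantumHalf

variable {ι U A : Type} [DecidableEq ι] [Ring U] [Algebra ℂ U] [Ring A] [Algebra ℂ A]
  (H : QuantumHalf ι U A)

lemma word_mul_K (i : ι) (w : List ι) : ∃ c : ℂ, H.word w * H.K i = c • (H.K i * H.word w) :=
  ⟨(H.q ^ H.wt i w)⁻¹, by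
    rw [H.K_word, smul_smul, inv_mul_cancel₀ (zpow_ne_zero _ H.q_ne), one_smul]⟩

lemma word_mul_Ki (i : ι) (w : List ι) : ∃ c : ℂ, H.word w * H.Ki i = c • (H.Ki i * H.word w) :=
  ⟨(H.q ^ (-H.wt i w))⁻¹, by
    rw [H.Ki_word, smul_smul, inv_mul_cancel₀ (zpow_ne_zero _ H.q_ne), one_smul]⟩

end QuantumHalf

namespace UqslData

variable {q : ℝ} {N : ℕ} {D : UqslData q N} {r : ℕ}

lemma mul_sub_smul_mem_Jsub {k : D.U} (hk : k ∈ D.Ksub r) (u : D.U) :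
    k * u - Coalgebra.counit (R := ℂ) k • u ∈ D.Jsub r := by
  refine Submodule.subset_span ⟨k - algebraMap ℂ D.U (Coalgebra.counit (R := ℂ) k),
    sub_mem hk (Subalgebra.algebraMap_mem _ _), ?_, u, ?_⟩
  · rw [map_sub, Bialgebra.counit_algebraMap, sub_self]
  · rw [sub_mul, Algebra.smul_def]

lemma mul_mem_Jsub {z : D.U} (hz : z ∈ D.Jsub r) (u : D.U) : z * u ∈ D.Jsub r := by
  induction hz using Submodule.span_induction with
  | mem z hz =>
    obtain ⟨k, hk, h0, v, rfl⟩ := hz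
    exact Submodule.subset_span ⟨k, hk, h0, v * u, mul_assoc _ _ _⟩
  | zero => rw [zero_mul]; exact zero_mem _
  | add a b _ _ ha hb => rw [add_mul]; exact add_mem ha hb
  | smul c a _ ha => rw [smul_mul_assoc]; exact Submodule.smul_mem _ _ ha

lemma E_mul_mem_Jsub {i : ℕ} (hi : i ∈ Finset.Icc 1 (N - 1)) (hr : i ≠ r) (u : D.U) :
    D.E i * u ∈ D.Jsub r :=
  Submodule.subset_span ⟨D.E i, Algebra.subset_adjoin (Or.inl ⟨i, hi, hr, Or.inl rfl⟩),
    D.counit_E i hi, u, rfl⟩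

lemma F_mul_mem_Jsub {i : ℕ} (hi : i ∈ Finset.Icc 1 (N - 1)) (hr : i ≠ r) (u : D.U) :
    D.F i * u ∈ D.Jsub r :=
  Submodule.subset_span ⟨D.F i, Algebra.subset_adjoin (Or.inl ⟨i, hi, hr, Or.inr rfl⟩),
    D.counit_F i hi, u, rfl⟩

lemma Kg_mul_sub_mem_Jsub {i : ℕ} (hi : i ∈ Finset.Icc 1 (N - 1)) (u : D.U) :
    D.Kg i * u - u ∈ D.Jsub r := by
  have := mul_sub_smul_mem_Jsub (r := r) (k := D.Kg i)
    (Algebra.subset_adjoin (Or.inr ⟨i, hi, Or.inl rfl⟩)) u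
  rwa [D.counit_Kg i hi, one_smul] at this

lemma Ki_mul_sub_mem_Jsub {i : ℕ} (hi : i ∈ Finset.Icc 1 (N - 1)) (u : D.U) :
    D.Ki i * u - u ∈ D.Jsub r := by
  have := mul_sub_smul_mem_Jsub (r := r) (k := D.Ki i)
    (Algebra.subset_adjoin (Or.inr ⟨i, hi, Or.inr rfl⟩)) u
  rwa [D.counit_Ki i hi, one_smul] at this

end UqslData

lemma exists_finite_coordinates {V : Type*} [AddCommGroup V] [Module ℂ V] {W : Set V}
    (hW : W.Finite) : ∃ (n : ℕ) (v : Fin n → V) (f : Fin n → V →ₗ[ℂ] ℂ),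
      (∀ k, v k ∈ Submodule.span ℂ W) ∧ ∀ w ∈ W, w = ∑ k, f k w • v k := by
  have := FiniteDimensional.span_of_finite ℂ hW
  set b := Module.finBasis ℂ (Submodule.span ℂ W)
  choose f hf using fun k => LinearMap.exists_extend (b.coord k)
  refine ⟨_, fun k => b k, f, fun k => (b k).2, fun w hw => ?_⟩
  have h1 := congrArg Subtype.val (b.sum_repr ⟨w, Submodule.subset_span hw⟩)
  simp only [AddSubmonoidClass.coe_finsetSum, Submodule.coe_smul] at h1
  rw [← h1]
  refine Finset.sum_congr rfl fun k _ => ?_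
  rw [h1, ← Module.Basis.coord_apply, ← hf k]
  rfl

namespace QslnFun

variable {q : ℝ} {N : ℕ} {D : UqslData q N} (P : QslnFun q N D)

section Bmod

variable {r : ℕ}

lemma mem_Bmod_iff {b : P.A} : b ∈ P.Bmod r ↔
    ∀ k ∈ D.Ksub r, P.hitL k b = Coalgebra.counit (R := ℂ) k • b := by
  simp only [Bmod, Submodule.mem_iInf, LinearMap.mem_ker, hitL_sub_left, hitL_algebraMap,
    sub_eq_zero, Subtype.forall]

lemma pair_eq_zero_of_mem_Jsub {x : D.U} (hx : x ∈ D.Jsub r) {b : P.A} (hb : b ∈ P.Bmod r) :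
    P.pair x b = 0 := by
  induction hx using Submodule.span_induction with
  | mem x hx =>
    obtain ⟨k, hk, h0, u, rfl⟩ := hx
    rw [← pair_hitL, (P.mem_Bmod_iff.1 hb) k hk, h0, zero_smul, map_zero]
  | zero => simp
  | add a b _ _ ha hb => simp [ha, hb]
  | smul c a _ ha => simp [ha]

lemma mem_Bmod_of_generators {b : P.A}
    (hE : ∀ i ∈ Finset.Icc 1 (N - 1), i ≠ r → P.hitL (D.E i) b = 0)
    (hF : ∀ i ∈ Finset.Icc 1 (N - 1), i ≠ r → P.hitL (D.F i) b = 0)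
    (hK : ∀ i ∈ Finset.Icc 1 (N - 1), P.hitL (D.Kg i) b = b) : b ∈ P.Bmod r := by
  refine P.mem_Bmod_iff.2 fun k hk => ?_
  induction hk using Algebra.adjoin_induction with
  | mem k hk =>
    rcases hk with ⟨i, hi, hir, rfl | rfl⟩ | ⟨i, hi, rfl | rfl⟩
    · rw [hE i hi hir, D.counit_E i hi, zero_smul]
    · rw [hF i hi hir, D.counit_F i hi, zero_smul]
    · rw [hK i hi, D.counit_Kg i hi, one_smul]
    · rw [D.counit_Ki i hi, hitL_Ki_of_hitL_Kg P hi one_ne_zero (by rw [hK i hi, one_smul]),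
        inv_one]
  | algebraMap z => rw [hitL_algebraMap, Bialgebra.counit_algebraMap]
  | add x y _ _ hx hy => rw [hitL_add_left, hx, hy, map_add, add_smul]
  | mul x y _ _ hx hy =>
    rw [hitL_mul_left, hx, map_smul, hy, smul_smul, Bialgebra.counit_mul]

end Bmod

variable (hq : Transcendental ℚ q) (r : Node N)

open MulOpposite in
lemma mul_mem_Bmod {n : ℕ} {β β' : Multiset (Node N)} {d : P.A} {d' : P.Aᵐᵒᵖ}
    (hd : (P.halfPos hq r).IsExt n β d) (hd' : (P.halfNeg hq r).IsExt n β' d') :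
    d * unop d' ∈ P.Bmod r.1 := by
  have hF : ∀ i : Node N, P.hitL (D.F i.1) d = 0 := hd.hL_F
  have hE : ∀ i : Node N, i ≠ r → P.hitL (D.E i.1) d = 0 := fun i hi => hd.hL_E hi
  have hF' : ∀ i : Node N, i ≠ r → P.hitL (D.F i.1) (unop d') = 0 := fun i hi =>
    congrArg unop (hd'.hL_E hi)
  have hE' : ∀ i : Node N, P.hitL (D.E i.1) (unop d') = 0 := fun i => congrArg unop (hd'.hL_F i)
  refine P.mem_Bmod_of_generators (fun i hi hir => ?_) (fun i hi hir => ?_) fun i hi => ?_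
  · rw [P.hitL_E_mul hi, hE ⟨i, hi⟩ (fun h => hir (congrArg Subtype.val h)), hE' ⟨i, hi⟩,
      zero_mul, mul_zero, add_zero]
  · rw [P.hitL_F_mul hi, hF ⟨i, hi⟩, hF' ⟨i, hi⟩ (fun h => hir (congrArg Subtype.val h)),
      zero_mul, mul_zero, add_zero]
  · have h1 : P.hitL (D.Kg i) d = (if (⟨i, hi⟩ : Node N) = r then (q : ℂ) ^ n else 1) • d :=
      hd.hL_K ⟨i, hi⟩
    have h2 : P.hitL (D.Kg i) (unop d') =
        (if (⟨i, hi⟩ : Node N) = r then (q : ℂ) ^ n else 1)⁻¹ • unop d' :=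
      P.eq_of_pair fun v => by
        rw [pair_hitL, map_smul]
        exact hd'.pair_Ki ⟨i, hi⟩ v
    have h3 : (if (⟨i, hi⟩ : Node N) = r then (q : ℂ) ^ n else 1) ≠ 0 :=
      QuantumHalf.IsExt.chi_ne (H := P.halfPos hq r) n ⟨i, hi⟩
    rw [P.hitL_Kg_mul hi, h1, h2, smul_mul_smul_comm, mul_inv_cancel₀ h3, one_smul]

open MulOpposite in
lemma pair_wordNeg_mul_wordPos {n : ℕ} {β : Multiset (Node N)} {d : P.A}
    (hd : (P.halfPos hq r).IsExt n β d) (v w : List (Node N)) (hw : w.length ≤ β.card)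
    (b : P.A) :
    P.pair ((P.halfNeg hq r).word v * (P.halfPos hq r).word w) (d * b) =
      P.pair ((P.halfPos hq r).word w) d * P.pair ((P.halfNeg hq r).word v) b := by
  have hv : ∀ b, P.hitL ((P.halfNeg hq r).word v) (d * b) =
      d * P.hitL ((P.halfNeg hq r).word v) b := by
    induction v with
    | nil => intro b; simp [hitL_one_left]
    | cons i v ih =>
      intro b
      have hF : P.hitL (D.F i.1) d = 0 := hd.hL_F i
      have hi : (P.halfNeg hq r).E i = D.F i.1 := rfl
      rw [QuantumHalf.word_cons, hi, hitL_mul_left, hitL_mul_left, P.hitL_F_mul i.2, hF,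
        zero_mul, zero_add, ih]
  have h1 : P.pair 1 (P.hitL ((P.halfNeg hq r).word v) b) =
      P.pair ((P.halfNeg hq r).word v) b := by rw [pair_hitL, mul_one]
  rw [← pair_hitL, hv, ← h1]
  exact hd.pair_word_mul w hw _

/-- Linear combinations of products of words in the `F i` and words in the `E i`. -/
def triang : (List (Node N) →₀ (List (Node N) →₀ ℂ)) →ₗ[ℂ] D.U :=
  Finsupp.lsum ℂ fun w =>
    (LinearMap.mulRight ℂ ((P.halfPos hq r).word w)).comp (P.halfNeg hq r).ev

lemma triang_apply (s : List (Node N) →₀ (List (Node N) →₀ ℂ)) : P.triang hq r s =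
    ∑ w ∈ s.support, (P.halfNeg hq r).ev (s w) * (P.halfPos hq r).word w := rfl

/-- The sum of `K⁺U` and the span of products of words in the `F i` and words in the `E i`,
the length of the latter being restricted. -/
def filt (p : ℕ → Prop) : Submodule ℂ D.U :=
  D.Jsub r.1 ⊔ (Finsupp.supported (List (Node N) →₀ ℂ) ℂ {w | p w.length}).map (P.triang hq r)

variable {p : ℕ → Prop}

lemma filt_le {X : Submodule ℂ D.U} (hJ : D.Jsub r.1 ≤ X)
    (hX : ∀ v w, p w.length → (P.halfNeg hq r).word v * (P.halfPos hq r).word w ∈ X) :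
    P.filt hq r p ≤ X := by
  refine sup_le hJ (Submodule.map_le_iff_le_comap.2 fun s hs => ?_)
  rw [Submodule.mem_comap, triang_apply]
  refine Submodule.sum_mem _ fun w hw => ?_
  have hw' : p w.length := hs hw
  induction s w using Finsupp.induction_linear with
  | zero => simp
  | add f g hf hg => rw [map_add, add_mul]; exact add_mem hf hg
  | single v z =>
    rw [QuantumHalf.ev_single, smul_mul_assoc]
    exact X.smul_mem _ (hX v w hw')

lemma ev_mul_word_mem_filt (σ : List (Node N) →₀ ℂ) {w : List (Node N)} (hw : p w.length) :
    (P.halfNeg hq r).ev σ * (P.halfPos hq r).word w ∈ P.filt hq r p := by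
  refine Submodule.mem_sup_right ⟨Finsupp.single w σ, ?_, ?_⟩
  · exact Finsupp.single_mem_supported _ _ hw
  · simp [triang]

lemma Jsub_le_filt : D.Jsub r.1 ≤ P.filt hq r p := le_sup_left

lemma word_mul_word_mem_filt (v : List (Node N)) {w : List (Node N)} (hw : p w.length) :
    (P.halfNeg hq r).word v * (P.halfPos hq r).word w ∈ P.filt hq r p := by
  simpa using P.ev_mul_word_mem_filt hq r (Finsupp.single v 1) hw

lemma mul_Kg_mem_filt (j : Node N) {z : D.U} (hz : z ∈ P.filt hq r p) :
    z * D.Kg j.1 ∈ P.filt hq r p := by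
  suffices h : P.filt hq r p ≤ (P.filt hq r p).comap (LinearMap.mulRight ℂ (D.Kg j.1)) from h hz
  refine P.filt_le hq r (fun z hz => ?_) fun v w hw => ?_
  · exact P.Jsub_le_filt hq r (UqslData.mul_mem_Jsub hz _)
  · obtain ⟨c, hc⟩ := (P.halfPos hq r).word_mul_K j w
    obtain ⟨c', hc'⟩ := (P.halfNeg hq r).word_mul_Ki j v
    change _ * D.Kg j.1 = c • (D.Kg j.1 * _) at hc
    change _ * D.Kg j.1 = c' • (D.Kg j.1 * _) at hc'
    rw [Submodule.mem_comap, LinearMap.mulRight_apply, mul_assoc, hc, mul_smul_comm, ← mul_assoc,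
      hc', smul_mul_assoc, mul_assoc]
    refine Submodule.smul_mem _ _ (Submodule.smul_mem _ _ ?_)
    exact (Submodule.sub_mem_iff_left _ (P.word_mul_word_mem_filt hq r v hw)).1
      (P.Jsub_le_filt hq r (UqslData.Kg_mul_sub_mem_Jsub j.2 _))

lemma mul_Ki_mem_filt (j : Node N) {z : D.U} (hz : z ∈ P.filt hq r p) :
    z * D.Ki j.1 ∈ P.filt hq r p := by
  suffices h : P.filt hq r p ≤ (P.filt hq r p).comap (LinearMap.mulRight ℂ (D.Ki j.1)) from h hz
  refine P.filt_le hq r (fun z hz => ?_) fun v w hw => ?_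
  · exact P.Jsub_le_filt hq r (UqslData.mul_mem_Jsub hz _)
  · obtain ⟨c, hc⟩ := (P.halfPos hq r).word_mul_Ki j w
    obtain ⟨c', hc'⟩ := (P.halfNeg hq r).word_mul_K j v
    change _ * D.Ki j.1 = c • (D.Ki j.1 * _) at hc
    change _ * D.Ki j.1 = c' • (D.Ki j.1 * _) at hc'
    rw [Submodule.mem_comap, LinearMap.mulRight_apply, mul_assoc, hc, mul_smul_comm, ← mul_assoc,
      hc', smul_mul_assoc, mul_assoc]
    refine Submodule.smul_mem _ _ (Submodule.smul_mem _ _ ?_)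
    exact (Submodule.sub_mem_iff_left _ (P.word_mul_word_mem_filt hq r v hw)).1
      (P.Jsub_le_filt hq r (UqslData.Ki_mul_sub_mem_Jsub j.2 _))

lemma ev_mul_Ki_mul_word_mem_filt (σ : List (Node N) →₀ ℂ) (j : Node N) {w : List (Node N)}
    (hw : p w.length) : (P.halfNeg hq r).ev σ * D.Ki j.1 * (P.halfPos hq r).word w ∈
      P.filt hq r p := by
  have h : D.Ki j.1 * (P.halfPos hq r).word w = _ := (P.halfPos hq r).Ki_word j w
  rw [mul_assoc, h, mul_smul_comm, ← mul_assoc]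
  exact Submodule.smul_mem _ _ (P.mul_Ki_mem_filt hq r j (P.ev_mul_word_mem_filt hq r σ hw))

lemma word_mul_ev_mem_filt (v : List (Node N)) (t : List (Node N) →₀ ℂ) :
    (P.halfNeg hq r).word v * (P.halfPos hq r).ev t ∈ P.filt hq r fun _ => True := by
  induction t using Finsupp.induction_linear with
  | zero => rw [map_zero, mul_zero]; exact zero_mem _
  | add f g hf hg => rw [map_add, mul_add]; exact add_mem hf hg
  | single w z =>
    rw [QuantumHalf.ev_single, mul_smul_comm]
    exact Submodule.smul_mem _ _ (P.word_mul_word_mem_filt hq r v trivial)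

lemma mul_E_mem_filt (i : Node N) {z : D.U} (hz : z ∈ P.filt hq r fun _ => True) :
    z * D.E i.1 ∈ P.filt hq r fun _ => True := by
  suffices h : P.filt hq r (fun _ => True) ≤
    (P.filt hq r fun _ => True).comap (LinearMap.mulRight ℂ (D.E i.1)) from h hz
  refine P.filt_le hq r (fun z hz => ?_) fun v w _ => ?_
  · rw [Submodule.mem_comap, LinearMap.mulRight_apply]
    exact P.Jsub_le_filt hq r (UqslData.mul_mem_Jsub hz _)
  have h : (P.halfPos hq r).word w * D.E i.1 = (P.halfPos hq r).word (w ++ [i]) := by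
    simp [QuantumHalf.word, halfPos]
  rw [Submodule.mem_comap, LinearMap.mulRight_apply, mul_assoc, h]
  exact P.word_mul_word_mem_filt hq r _ trivial

lemma mul_F_mem_filt (i : Node N) {z : D.U} (hz : z ∈ P.filt hq r fun _ => True) :
    z * D.F i.1 ∈ P.filt hq r fun _ => True := by
  suffices h : P.filt hq r (fun _ => True) ≤
    (P.filt hq r fun _ => True).comap (LinearMap.mulRight ℂ (D.F i.1)) from h hz
  refine P.filt_le hq r (fun z hz => ?_) fun v w _ => ?_
  · rw [Submodule.mem_comap, LinearMap.mulRight_apply]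
    exact P.Jsub_le_filt hq r (UqslData.mul_mem_Jsub hz _)
  have h := (P.halfPos hq r).ev_F i (Finsupp.single w 1)
  rw [QuantumHalf.ev_single, one_smul, sub_eq_iff_eq_add] at h
  change _ * D.F i.1 = _ • (_ * D.Kg i.1 - D.Ki i.1 * _) + D.F i.1 * _ at h
  rw [Submodule.mem_comap, LinearMap.mulRight_apply, mul_assoc, h, mul_add, mul_smul_comm,
    mul_sub, ← mul_assoc, ← mul_assoc, ← mul_assoc]
  refine add_mem (Submodule.smul_mem _ _ (sub_mem ?_ ?_)) ?_
  · exact P.mul_Kg_mem_filt hq r i (P.word_mul_ev_mem_filt hq r _ _)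
  · obtain ⟨c, hc⟩ := (P.halfNeg hq r).word_mul_K i v
    change _ * D.Ki i.1 = c • (D.Ki i.1 * _) at hc
    rw [hc, smul_mul_assoc, mul_assoc]
    exact Submodule.smul_mem _ _ ((Submodule.sub_mem_iff_left _
      (P.word_mul_ev_mem_filt hq r _ _)).1
        (P.Jsub_le_filt hq r (UqslData.Ki_mul_sub_mem_Jsub i.2 _)))
  · have h : (P.halfNeg hq r).word v * D.F i.1 = (P.halfNeg hq r).word (v ++ [i]) := by
      simp [QuantumHalf.word, halfNeg]
    rw [h]
    exact P.word_mul_word_mem_filt hq r _ trivial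

lemma mul_mem_filt (x : D.U) : ∀ z ∈ P.filt hq r (fun _ => True),
    z * x ∈ P.filt hq r fun _ => True := by
  have hx : x ∈ Algebra.adjoin ℂ {x : D.U | ∃ i ∈ Finset.Icc 1 (N - 1),
      x = D.E i ∨ x = D.F i ∨ x = D.Kg i ∨ x = D.Ki i} := by rw [D.gen]; trivial
  induction hx using Algebra.adjoin_induction with
  | mem x hx =>
    obtain ⟨i, hi, rfl | rfl | rfl | rfl⟩ := hx
    · exact fun z hz => P.mul_E_mem_filt hq r ⟨i, hi⟩ hz
    · exact fun z hz => P.mul_F_mem_filt hq r ⟨i, hi⟩ hz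
    · exact fun z hz => P.mul_Kg_mem_filt hq r ⟨i, hi⟩ hz
    · exact fun z hz => P.mul_Ki_mem_filt hq r ⟨i, hi⟩ hz
  | algebraMap c =>
    intro z hz
    rw [Algebra.algebraMap_eq_smul_one, mul_smul_comm, mul_one]
    exact Submodule.smul_mem _ _ hz
  | add x y _ _ hx hy =>
    intro z hz
    rw [mul_add]
    exact add_mem (hx z hz) (hy z hz)
  | mul x y _ _ hx hy =>
    intro z hz
    rw [← mul_assoc]
    exact hy _ (hx z hz)

lemma mem_filt_true (x : D.U) : x ∈ P.filt hq r fun _ => True := by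
  have h1 : (P.halfNeg hq r).word [] * (P.halfPos hq r).word [] ∈ P.filt hq r fun _ => True :=
    P.word_mul_word_mem_filt hq r _ trivial
  rw [QuantumHalf.word_nil, QuantumHalf.word_nil, mul_one] at h1
  simpa using P.mul_mem_filt hq r x 1 h1

lemma exists_mem_filt (x : D.U) : ∃ m, x ∈ P.filt hq r (· < m) := by
  obtain ⟨y, hy, z, ⟨s, -, rfl⟩, rfl⟩ := Submodule.mem_sup.1 (P.mem_filt_true hq r x)
  refine ⟨s.support.sup List.length + 1, add_mem (P.Jsub_le_filt hq r hy) ?_⟩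
  exact Submodule.mem_sup_right ⟨s, fun w hw => Nat.lt_succ_of_le (Finset.le_sup hw), rfl⟩

lemma leadSpan_neg_le (M : ℕ → Prop) : (P.halfNeg hq r).leadSpan M ≤ D.Jsub r.1 := by
  refine Submodule.span_le.2 ?_
  rintro _ ⟨j, w, hj, -, rfl⟩
  exact UqslData.F_mul_mem_Jsub j.2 (fun h => hj (Subtype.ext h)) _

lemma ev_mul_leadSpan_mem_filt {m : ℕ} (σ : List (Node N) →₀ ℂ) {u : D.U}
    (hu : u ∈ (P.halfPos hq r).leadSpan (· = m)) :
    (P.halfNeg hq r).ev σ * u ∈ P.filt hq r (· < m) := by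
  induction hu using Submodule.span_induction with
  | mem u hu =>
    obtain ⟨j, w, hj, hw, rfl⟩ := hu
    have h := (P.halfNeg hq r).ev_F j σ
    rw [sub_eq_iff_eq_add] at h
    change _ * D.E j.1 = _ • (_ * D.Ki j.1 - D.Kg j.1 * _) + D.E j.1 * _ at h
    change _ * (D.E j.1 * _) ∈ _
    have hw' : w.length < m := by omega
    rw [← mul_assoc, h, add_mul, smul_mul_assoc, sub_mul, mul_assoc (D.Kg j.1),
      mul_assoc (D.E j.1)]
    refine add_mem (Submodule.smul_mem _ _ (sub_mem ?_ ?_)) ?_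
    · exact P.ev_mul_Ki_mul_word_mem_filt hq r _ j hw'
    · exact (Submodule.sub_mem_iff_left _ (P.ev_mul_word_mem_filt hq r _ hw')).1
        (P.Jsub_le_filt hq r (UqslData.Kg_mul_sub_mem_Jsub j.2 _))
    · exact P.Jsub_le_filt hq r (UqslData.E_mul_mem_Jsub j.2 (fun h => hj (Subtype.ext h)) _)
  | zero => simp
  | add a b _ _ ha hb => rw [mul_add]; exact add_mem ha hb
  | smul z a _ ha => rw [mul_smul_comm]; exact Submodule.smul_mem _ _ ha

end QslnFun

namespace QslnFun

variable {q : ℝ} {N : ℕ} {D : UqslData q N} (P : QslnFun q N D)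
  (hq : Transcendental ℚ q) (r : Node N)

open MulOpposite in
lemma pair_ev_mul_word {n : ℕ} {β : Multiset (Node N)} {d : P.A}
    (hd : (P.halfPos hq r).IsExt n β d) (σ : List (Node N) →₀ ℂ) (w : List (Node N))
    (hw : w.length ≤ β.card) (b : P.A) :
    P.pair ((P.halfNeg hq r).ev σ * (P.halfPos hq r).word w) (d * b) =
      P.pair ((P.halfPos hq r).word w) d * P.pair ((P.halfNeg hq r).ev σ) b := by
  induction σ using Finsupp.induction_linear with
  | zero => simp
  | add f g hf hg =>
    rw [map_add, add_mul, map_add, LinearMap.add_apply, hf, hg, map_add, LinearMap.add_apply,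
      mul_add]
  | single v z =>
    rw [QuantumHalf.ev_single, smul_mul_assoc, map_smul, LinearMap.smul_apply,
      P.pair_wordNeg_mul_wordPos hq r hd v w hw, map_smul, LinearMap.smul_apply, smul_eq_mul,
      smul_eq_mul, mul_left_comm]

open MulOpposite in
/-- The negative parts of an element orthogonal to the quantum Grassmannian, weighted by
the values of an extremal element, lie in `K⁺U`. -/
lemma sum_pair_smul_mem_Jsub {m : ℕ} {s : List (Node N) →₀ (List (Node N) →₀ ℂ)}
    (hs : ∀ w ∈ s.support, w.length ≤ m) {y : D.U} (hy : y ∈ D.Jsub r.1)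
    (hx : ∀ b ∈ P.Bmod r.1, P.pair (y + P.triang hq r s) b = 0)
    {n : ℕ} {β : Multiset (Node N)} {d : P.A} (hd : (P.halfPos hq r).IsExt n β d)
    (hβ : β.card = m) :
    ∑ w ∈ s.support, P.pair ((P.halfPos hq r).word w) d • (P.halfNeg hq r).ev (s w) ∈
      D.Jsub r.1 := by
  set τ := ∑ w ∈ s.support, P.pair ((P.halfPos hq r).word w) d • s w with hτ
  have hev : (P.halfNeg hq r).ev τ =
      ∑ w ∈ s.support, P.pair ((P.halfPos hq r).word w) d • (P.halfNeg hq r).ev (s w) := by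
    simp only [hτ, map_sum, map_smul]
  have horth : (P.halfNeg hq r).Orth ((P.halfNeg hq r).ev τ) := by
    intro n' β' d' hd'
    obtain ⟨e, he, hde⟩ := hd.exists_add n'
    obtain ⟨e', he', hde'⟩ := hd'.exists_add n
    rw [add_comm] at he'
    have hmem := P.mul_mem_Bmod hq r he he'
    have h0 := hx _ hmem
    rw [map_add, LinearMap.add_apply, P.pair_eq_zero_of_mem_Jsub hy hmem, zero_add, triang_apply,
      map_sum, LinearMap.sum_apply] at h0
    rw [← hde' τ]
    change P.pair ((P.halfNeg hq r).ev τ) (unop e') = 0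
    rw [hev, map_sum, LinearMap.sum_apply, ← h0]
    refine Finset.sum_congr rfl fun w hw => ?_
    have hwe : P.pair ((P.halfPos hq r).word w) e = P.pair ((P.halfPos hq r).word w) d := by
      have := hde (Finsupp.single w 1)
      rwa [QuantumHalf.ev_single, one_smul] at this
    rw [P.pair_ev_mul_word hq r he _ w (hβ ▸ hs w hw), hwe, map_smul, LinearMap.smul_apply,
      smul_eq_mul]
  rw [← hev]
  exact P.leadSpan_neg_le hq r (fun _ => True) (horth.mem_leadSpan fun _ _ => trivial)

lemma orth_ev_sum {m : ℕ} {s : List (Node N) →₀ (List (Node N) →₀ ℂ)}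
    (hs : ∀ w ∈ s.support, w.length ≤ m) {y : D.U} (hy : y ∈ D.Jsub r.1)
    (hx : ∀ b ∈ P.Bmod r.1, P.pair (y + P.triang hq r s) b = 0)
    (f : (D.U ⧸ D.Jsub r.1) →ₗ[ℂ] ℂ) :
    (P.halfPos hq r).Orth ((P.halfPos hq r).ev
      (∑ w ∈ s.support with w.length = m,
        Finsupp.single w (f ((D.Jsub r.1).mkQ ((P.halfNeg hq r).ev (s w)))))) := by
  intro n β d hd
  change P.pair _ d = 0
  have hword : ∀ w : List (Node N), w.length ≠ β.card → P.pair ((P.halfPos hq r).word w) d = 0 :=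
    fun w hw => hd.pair_word w fun h => hw (by rw [← h, Multiset.coe_card])
  simp only [map_sum, QuantumHalf.ev_single, map_smul, LinearMap.sum_apply, LinearMap.smul_apply,
    smul_eq_mul]
  by_cases hβ : β.card = m
  · have h := P.sum_pair_smul_mem_Jsub hq r hs hy hx hd hβ
    rw [← Submodule.Quotient.mk_eq_zero, ← Submodule.mkQ_apply] at h
    have h' := congrArg f h
    rw [map_sum, map_sum, map_zero] at h'
    rw [Finset.sum_filter]
    refine (Finset.sum_congr rfl fun w _ => ?_).trans h'
    rw [map_smul, map_smul, smul_eq_mul]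
    split_ifs with hw
    · exact mul_comm _ _
    · rw [hword w (fun h => hw (h.trans hβ)), zero_mul]
  · refine Finset.sum_eq_zero fun w hw => ?_
    rw [hword w fun h => hβ (h.symm.trans (Finset.mem_filter.1 hw).2), mul_zero]

lemma mem_filt_of_orthogonal {m : ℕ} {x : D.U} (hm : x ∈ P.filt hq r (· < m + 1))
    (hx : ∀ b ∈ P.Bmod r.1, P.pair x b = 0) : x ∈ P.filt hq r (· < m) := by
  obtain ⟨y, hy, _, ⟨s, hs, rfl⟩, rfl⟩ := Submodule.mem_sup.1 hm
  have hs' : ∀ w ∈ s.support, w.length ≤ m := fun w hw => Nat.le_of_lt_succ (hs hw)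
  refine add_mem (P.Jsub_le_filt hq r hy) ?_
  set Hn := P.halfNeg hq r with hHn
  set Hp := P.halfPos hq r with hHp
  set W := s.support.filter (fun w => w.length = m) with hW
  have hsplit : P.triang hq r s = ∑ w ∈ W, Hn.ev (s w) * Hp.word w +
      ∑ w ∈ s.support with ¬ w.length = m, Hn.ev (s w) * Hp.word w :=
    (Finset.sum_filter_add_sum_filter_not _ _ _).symm
  rw [hsplit]
  refine add_mem ?_ (Submodule.sum_mem _ fun w hw => ?_)
  · obtain ⟨k, v, f, hv, hf⟩ := exists_finite_coordinates
      (W.finite_toSet.image fun w => (D.Jsub r.1).mkQ (Hn.ev (s w)))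
    have hlift : ∀ i, ∃ σ, (D.Jsub r.1).mkQ (Hn.ev σ) = v i := fun i => by
      have h1 : Submodule.span ℂ ((fun w => (D.Jsub r.1).mkQ (Hn.ev (s w))) '' W) ≤
          LinearMap.range ((D.Jsub r.1).mkQ.comp Hn.ev) := by
        refine Submodule.span_le.2 ?_
        rintro _ ⟨w, -, rfl⟩
        exact ⟨s w, rfl⟩
      exact h1 (hv i)
    choose σ hσ using hlift
    set c : Fin k → List (Node N) → ℂ := fun i w => f i ((D.Jsub r.1).mkQ (Hn.ev (s w))) with hc
    have hlead : ∀ i, Hn.ev (σ i) * Hp.ev (∑ w ∈ W, Finsupp.single w (c i w)) ∈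
        P.filt hq r (· < m) := fun i => by
      refine P.ev_mul_leadSpan_mem_filt hq r (σ i) ?_
      refine QuantumHalf.Orth.mem_leadSpan (fun w hw => ?_) (P.orth_ev_sum hq r hs' hy hx (f i))
      obtain ⟨w', hw', h⟩ := Finset.mem_biUnion.1 (Finsupp.support_finsetSum hw)
      rw [Finset.mem_singleton.1 (Finsupp.support_single_subset h)]
      exact (Finset.mem_filter.1 hw').2
    have hdiff : ∑ w ∈ W, Hn.ev (s w) * Hp.word w -
        ∑ i, Hn.ev (σ i) * Hp.ev (∑ w ∈ W, Finsupp.single w (c i w)) ∈ D.Jsub r.1 := by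
      have hcomm : ∑ i, Hn.ev (σ i) * Hp.ev (∑ w ∈ W, Finsupp.single w (c i w)) =
          ∑ w ∈ W, (∑ i, c i w • Hn.ev (σ i)) * Hp.word w := by
        simp only [map_sum, QuantumHalf.ev_single, Finset.mul_sum, Finset.sum_mul, mul_smul_comm,
          smul_mul_assoc]
        exact Finset.sum_comm
      rw [hcomm, ← Finset.sum_sub_distrib]
      refine Submodule.sum_mem _ fun w hw => ?_
      rw [← sub_mul]
      refine UqslData.mul_mem_Jsub ?_ _
      rw [← Submodule.Quotient.mk_eq_zero, ← Submodule.mkQ_apply, map_sub, map_sum, sub_eq_zero]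
      simp only [map_smul, hσ]
      exact hf _ ⟨w, hw, rfl⟩
    exact (Submodule.sub_mem_iff_left _ (Submodule.sum_mem _ fun i _ => hlead i)).1
      (P.Jsub_le_filt hq r hdiff)
  · obtain ⟨h1, h2⟩ := Finset.mem_filter.1 hw
    exact P.ev_mul_word_mem_filt hq r _ (lt_of_le_of_ne (hs' w h1) h2)

include hq in
lemma mem_Jsub_of_orthogonal {x : D.U} (hx : ∀ b ∈ P.Bmod r.1, P.pair x b = 0) :
    x ∈ D.Jsub r.1 := by
  obtain ⟨m, hm⟩ := P.exists_mem_filt hq r x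
  induction m with
  | zero => exact P.filt_le hq r le_rfl (fun _ _ h => absurd h (Nat.not_lt_zero _)) hm
  | succ m ih => exact ih (P.mem_filt_of_orthogonal hq r hm hx)

end QslnFun

end

/-- Lemma `nonzero`.  For every nonzero primitive element
`x ∈ P(Ū)`, the functional `⟨·, x⟩ : B → ℂ` on the quantum Grassmannian
`B = O_q(Gr(r,N))` is nonzero.  (Stated on representatives: `x ∈ U` represents a
primitive element of `Ū = U/K⁺U` and `x ∉ K⁺U`.) -/
theorem primitive_pairs_nontrivially_with_B
    (q : ℝ) (hq : Transcendental ℚ q)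
    (N r : ℕ) (hN : 2 ≤ N) (hr1 : 1 ≤ r) (hr2 : r ≤ N - 1)
    (D : UqslData q N) (P : QslnFun q N D)
    (Bsub : Subalgebra ℂ P.A) (hB : Subalgebra.toSubmodule Bsub = P.Bmod r)
    (x : D.U) (hprim : D.IsPrimitiveMod r x) (hnz : x ∉ D.Jsub r) :
    ∃ b ∈ Bsub, P.pair x b ≠ 0 := by
  by_contra! h
  have hr : r ∈ Finset.Icc 1 (N - 1) := Finset.mem_Icc.2 ⟨hr1, hr2⟩
  refine hnz (P.mem_Jsub_of_orthogonal hq ⟨r, hr⟩ fun b hb => h b ?_)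
  rwa [← Subalgebra.mem_toSubmodule, hB]
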